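/- arXiv:2601.15692 — 2 statements merged into one kernel-verified Lean document; each statement's English description precedes it below -/
import Mathlib

section
/- Let K be a field of characteristic 0. Then the symbolic Rees algebra R_s(𝔭_K(5,103,169)) is not Noetherian; equivalently, it is not finitely generated as a K-algebra (equivalently, as an S-algebra). -/
open MvPolynomial

noncomputable section

/-- The weight function assigning degrees `a, b, c` to the variables `x, y, z`. -/
def wt (a b c : ℕ) : Fin 3 → ℕ := ![a, b, c]

/-- The `K`-algebra map `K[x,y,z] → K[T]`, `x ↦ T^a`, `y ↦ T^b`, `z ↦ T^c`. -/
def toPoly (K : Type*) [CommRing K] (a b c : ℕ) :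
    MvPolynomial (Fin 3) K →ₐ[K] Polynomial K :=
  aeval ![Polynomial.X ^ a, Polynomial.X ^ b, Polynomial.X ^ c]

/-- The space monomial prime `𝔭_K(a,b,c)`. -/
def pIdeal (K : Type*) [CommRing K] (a b c : ℕ) : Ideal (MvPolynomial (Fin 3) K) :=
  RingHom.ker (toPoly K a b c)

instance pIdeal_isPrime (K : Type*) [Field K] (a b c : ℕ) : (pIdeal K a b c).IsPrime :=
  RingHom.ker_isPrime _

/-- The `n`-th symbolic power `Q^{(n)} = Q^n A_Q ∩ A` of a prime ideal. -/
def symbPow {A : Type*} [CommRing A] (Q : Ideal A) [Q.IsPrime] (n : ℕ) : Ideal A :=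
  Ideal.comap (algebraMap A (Localization.AtPrime Q))
    (Ideal.map (algebraMap A (Localization.AtPrime Q)) (Q ^ n))

/-- The symbolic Rees algebra `A[Qt, Q^{(2)}t^2, …] ⊆ A[t]`. -/
def symbolicRees {A : Type*} [CommRing A] (Q : Ideal A) [Q.IsPrime] :
    Subalgebra A (Polynomial A) :=
  Algebra.adjoin A
    (⋃ n : ℕ, (fun p => Polynomial.C p * Polynomial.X ^ n) '' ((symbPow Q n : Ideal A) : Set A))

/-- The degree-`d` homogeneous component `[J]_d` of an ideal `J ⊆ K[x,y,z]`,
as a `K`-subspace. -/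
def gpiece (K : Type*) [CommRing K] (a b c : ℕ) (J : Ideal (MvPolynomial (Fin 3) K))
    (d : ℕ) : Submodule K (MvPolynomial (Fin 3) K) :=
  (Submodule.restrictScalars K J) ⊓ (weightedHomogeneousSubmodule K (wt a b c) d)

end

namespace SpaceMonomial

noncomputable section

variable {K : Type*} [Field K]

/-- The grading weights, with values in `ℤ`. -/
def wz : Fin 3 → ℤ := ![5, 103, 169]

lemma weight_wz (d : Fin 3 →₀ ℕ) :
    Finsupp.weight wz d = 5 * (d 0 : ℤ) + 103 * d 1 + 169 * d 2 := by
  rw [Finsupp.weight_apply, Finsupp.sum_fintype _ _ (by simp)]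
  simp [Fin.sum_univ_three, wz, mul_comm]

lemma monomial_eq_C_mul (d : Fin 3 →₀ ℕ) (c : K) :
    monomial d c = C c * (X 0 ^ d 0 * X 1 ^ d 1 * X 2 ^ d 2) := by
  rw [monomial_eq, Finsupp.prod_fintype _ _ (by simp)]
  simp [Fin.prod_univ_three]

section Order

variable {R σ : Type*} [CommRing R]

lemma mem_pow_idealOfVars_iff_le_order (n : ℕ) (p : MvPolynomial σ R) :
    p ∈ idealOfVars σ R ^ n ↔ (n : ℕ∞) ≤ (p : MvPowerSeries σ R).order := by
  rw [mem_pow_idealOfVars_iff']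
  constructor
  · intro h
    refine MvPowerSeries.le_order fun d hd => ?_
    rw [coeff_coe]
    exact h d (by exact_mod_cast hd)
  · intro h d hd
    rw [← coeff_coe]
    exact MvPowerSeries.coeff_of_lt_order (lt_of_lt_of_le (by exact_mod_cast hd) h)

lemma mem_pow_idealOfVars_of_mul [IsDomain R] {a b : MvPolynomial σ R} {m n : ℕ}
    (ha : a ∉ idealOfVars σ R ^ (m + 1)) (hab : a * b ∈ idealOfVars σ R ^ n) :
    b ∈ idealOfVars σ R ^ (n - m) := by
  rw [mem_pow_idealOfVars_iff_le_order] at *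
  rw [coe_mul, MvPowerSeries.order_mul] at hab
  have ha' : (a : MvPowerSeries σ R).order ≤ m := by
    rw [not_le] at ha
    exact Order.lt_add_one_iff_of_not_isMax (by simp) |>.mp (by exact_mod_cast ha)
  have h1 : (n : ℕ∞) ≤ m + (b : MvPowerSeries σ R).order :=
    hab.trans (by gcongr)
  rw [ENat.natCast_sub]
  exact tsub_le_iff_left.mpr h1

end Order

lemma mem_symbPow_iff {A : Type*} [CommRing A] (Q : Ideal A) [Q.IsPrime] (n : ℕ) (g : A) :
    g ∈ symbPow Q n ↔ ∃ h ∉ Q, h * g ∈ Q ^ n := by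
  rw [symbPow, Ideal.mem_comap,
    IsLocalization.algebraMap_mem_map_algebraMap_iff Q.primeCompl]
  rfl

lemma symbPow_mul_mem {A : Type*} [CommRing A] (Q : Ideal A) [Q.IsPrime] {m n : ℕ} {g h : A}
    (hg : g ∈ symbPow Q m) (hh : h ∈ symbPow Q n) : g * h ∈ symbPow Q (m + n) := by
  rw [mem_symbPow_iff] at *
  obtain ⟨a, ha, hag⟩ := hg
  obtain ⟨b, hb, hbh⟩ := hh
  refine ⟨a * b, fun hab => (Ideal.IsPrime.mem_or_mem ‹_› hab).elim ha hb, ?_⟩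
  rw [pow_add, show a * b * (g * h) = (a * g) * (b * h) by ring]
  exact Ideal.mul_mem_mul hag hbh

lemma mem_symbPow_zero {A : Type*} [CommRing A] (Q : Ideal A) [hQ : Q.IsPrime] (g : A) :
    g ∈ symbPow Q 0 := by
  rw [mem_symbPow_iff]
  exact ⟨1, fun h => hQ.ne_top ((Ideal.eq_top_iff_one _).mpr h), by simp⟩

lemma derivation_mem_pow {A : Type*} [CommRing A] (D : Derivation ℤ A A) (Q : Ideal A) (n : ℕ)
    {g : A} (hg : g ∈ Q ^ n) : D g ∈ Q ^ (n - 1) := by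
  induction n generalizing g with
  | zero => simp
  | succ n ih =>
    rw [pow_succ'] at hg
    refine Submodule.mul_induction_on hg (fun a ha b hb => ?_) (fun a b ha hb => ?_)
    · rw [D.leibniz, smul_eq_mul, smul_eq_mul]
      refine add_mem ?_ (Ideal.mul_mem_right _ _ hb)
      rcases n with _ | n
      · simp
      · exact pow_succ' Q n ▸ Ideal.mul_mem_mul ha (ih hb)
    · rw [map_add]; exact add_mem ha hb

lemma derivation_mem_symbPow {A : Type*} [CommRing A] (D : Derivation ℤ A A) (Q : Ideal A)
    [hQ : Q.IsPrime] (n : ℕ) {g : A} (hg : g ∈ symbPow Q n) : D g ∈ symbPow Q (n - 1) := by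
  rw [mem_symbPow_iff] at *
  obtain ⟨h, hh, hhg⟩ := hg
  refine ⟨h * h, fun H => (hQ.mem_or_mem H).elim hh hh, ?_⟩
  have h1 := derivation_mem_pow D Q n hhg
  rw [D.leibniz, smul_eq_mul, smul_eq_mul] at h1
  have h2 : h * h * D g = h * (h * D g + g * D h) - (h * g) * D h := by ring
  rw [h2]
  exact sub_mem (Ideal.mul_mem_left _ _ h1)
    (Ideal.mul_mem_right _ _ (Ideal.pow_le_pow_right (Nat.sub_le _ _) hhg))

/-- Local coordinates at `(1,1,1)` transversal to the monomial curve. -/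
def loc (K : Type*) [Field K] : MvPolynomial (Fin 3) K →ₐ[K] MvPolynomial (Fin 2) K :=
  aeval ![(1 + X 0) ^ 2, (1 + X 0) ^ 41, (1 + X 1) * (1 + X 0) ^ 67]

/-- The map `loc`, keeping track of the degree with an extra variable. -/
def gloc (K : Type*) [Field K] :
    MvPolynomial (Fin 3) K →ₐ[K] MvPolynomial (Fin 2) (Polynomial K) :=
  aeval ![C (Polynomial.X ^ 5) * (1 + X 0) ^ 2, C (Polynomial.X ^ 103) * (1 + X 0) ^ 41,
    C (Polynomial.X ^ 169) * ((1 + X 1) * (1 + X 0) ^ 67)]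

/-- The numerical degree of a monomial. -/
def deg (d : Fin 3 →₀ ℕ) : ℕ := 5 * d 0 + 103 * d 1 + 169 * d 2

lemma weight_wz_eq_deg (d : Fin 3 →₀ ℕ) : Finsupp.weight wz d = (deg d : ℤ) := by
  rw [weight_wz, deg]; push_cast; ring

lemma gloc_monomial (d : Fin 3 →₀ ℕ) (c : K) :
    gloc K (monomial d c) =
      C (Polynomial.X ^ deg d) * map (Polynomial.C) (loc K (monomial d c)) := by
  rw [monomial_eq_C_mul]
  simp only [gloc, loc, map_mul, map_pow, aeval_X, algHom_C, algebraMap_eq, map_C, map_add,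
    map_one, map_X, Matrix.cons_val_zero, Matrix.cons_val_one, Matrix.cons_val, deg,
    MvPolynomial.algebraMap_apply, Polynomial.algebraMap_eq]
  generalize (1 + X 0 : MvPolynomial (Fin 2) (Polynomial K)) = u
  generalize (1 + X 1 : MvPolynomial (Fin 2) (Polynomial K)) = v
  ring

lemma coeff_gloc (d : Fin 2 →₀ ℕ) (e : ℕ) (g : MvPolynomial (Fin 3) K) :
    (coeff d (gloc K g)).coeff e = coeff d (loc K (weightedHomogeneousComponent wz (e : ℤ) g)) := by
  induction g using MvPolynomial.induction_on' with
  | add p q hp hq => simp [hp, hq]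
  | monomial u c =>
    rw [gloc_monomial, coeff_C_mul, coeff_map, mul_comm, Polynomial.coeff_C_mul_X_pow,
      weightedHomogeneousComponent_of_mem (n := (deg u : ℤ)) (m := (e : ℤ))
        (isWeightedHomogeneous_monomial _ _ _ (weight_wz_eq_deg u))]
    by_cases h : e = deg u
    · rw [if_pos h, if_pos (by exact_mod_cast h)]
    · rw [if_neg h, if_neg (by exact_mod_cast h), map_zero, coeff_zero]

lemma constantCoeff_gloc (g : MvPolynomial (Fin 3) K) :
    constantCoeff (gloc K g) = toPoly K 5 103 169 g := by
  induction g using MvPolynomial.induction_on' with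
  | add p q hp hq => simp [hp, hq]
  | monomial u c =>
    rw [monomial_eq_C_mul]
    simp [gloc, toPoly, MvPolynomial.algebraMap_apply]

lemma gloc_mem_of_mem_symbPow {n : ℕ} {g : MvPolynomial (Fin 3) K}
    (hg : g ∈ symbPow (pIdeal K 5 103 169) n) :
    gloc K g ∈ idealOfVars (Fin 2) (Polynomial K) ^ n := by
  obtain ⟨h, hh, hhg⟩ := (mem_symbPow_iff _ _ _).mp hg
  have key : ∀ a : MvPolynomial (Fin 3) K, a ∈ pIdeal K 5 103 169 ↔
      gloc K a ∈ idealOfVars (Fin 2) (Polynomial K) ^ 1 := by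
    intro a
    rw [mem_pow_idealOfVars_iff', pIdeal, RingHom.mem_ker, ← constantCoeff_gloc]
    simp only [Nat.lt_one_iff, Finsupp.degree_eq_zero_iff, forall_eq, constantCoeff_eq]
  have h1 : (pIdeal K 5 103 169).map (gloc K) ≤ idealOfVars (Fin 2) (Polynomial K) := by
    rw [Ideal.map_le_iff_le_comap]
    intro a ha
    simpa using (key a).mp ha
  have h2 : gloc K h * gloc K g ∈ idealOfVars (Fin 2) (Polynomial K) ^ n := by
    rw [← map_mul]
    have := Ideal.mem_map_of_mem (gloc K) hhg
    rw [Ideal.map_pow] at this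
    exact Ideal.pow_right_mono h1 n this
  have h3 := mem_pow_idealOfVars_of_mul (m := 0) (by rwa [zero_add, ← key]) h2
  simpa using h3

lemma loc_component_mem {n : ℕ} {g : MvPolynomial (Fin 3) K}
    (hg : g ∈ symbPow (pIdeal K 5 103 169) n) (e : ℕ) :
    loc K (weightedHomogeneousComponent wz (e : ℤ) g) ∈ idealOfVars (Fin 2) K ^ n := by
  have := gloc_mem_of_mem_symbPow hg
  rw [mem_pow_idealOfVars_iff'] at *
  intro d hd
  rw [← coeff_gloc, this d hd, Polynomial.coeff_zero]

lemma add_identities {G : Type*} [AddCommGroup G] (a b : G) :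
    a = 5 • (2 • b + 41 • -a) + 2 • (103 • a + 5 • -b) ∧
    b = 103 • (2 • b + 41 • -a) + 41 • (103 • a + 5 • -b) ∧
    0 = 169 • (2 • b + 41 • -a) + (28 • a + 3 • -b) + 67 • (103 • a + 5 • -b) :=
  ⟨by module, by module, by module⟩

lemma unit_identities {G : Type*} [CommGroup G] (a b : G) :
    a = (b ^ 2 * a⁻¹ ^ 41) ^ 5 * (a ^ 103 * b⁻¹ ^ 5) ^ 2 ∧
    b = (b ^ 2 * a⁻¹ ^ 41) ^ 103 * (a ^ 103 * b⁻¹ ^ 5) ^ 41 ∧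
    1 = (b ^ 2 * a⁻¹ ^ 41) ^ 169 * (a ^ 28 * b⁻¹ ^ 3) * (a ^ 103 * b⁻¹ ^ 5) ^ 67 :=
  add_identities (Additive.ofMul a) (Additive.ofMul b)

lemma eval_eq_of_homogeneous {R : Type*} [CommRing R] [Algebra K R]
    (Ψ : MvPolynomial (Fin 3) K →ₐ[K] R) (a b : Rˣ) (ha : Ψ (X 0) = a) (hb : Ψ (X 1) = b)
    {e : ℤ} {g : MvPolynomial (Fin 3) K} (hg : IsWeightedHomogeneous wz g e) :
    Ψ g = ((b ^ 2 * a⁻¹ ^ 41) ^ e : Rˣ) *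
      aeval ![((a ^ 103 * b⁻¹ ^ 5 : Rˣ) : R) - 1,
        Ψ (X 2) * ((a ^ 28 * b⁻¹ ^ 3 : Rˣ) : R) - 1] (loc K g) := by
  set l : Rˣ := b ^ 2 * a⁻¹ ^ 41 with hl
  rw [g.as_sum]
  simp only [map_sum, Finset.mul_sum]
  refine Finset.sum_congr rfl fun d hd => ?_
  have hw := hg (mem_support_iff.mp hd)
  rw [weight_wz_eq_deg] at hw
  rw [← hw, zpow_natCast, monomial_eq_C_mul]
  have hx : (a : R) = l ^ 5 * ((a ^ 103 * b⁻¹ ^ 5 : Rˣ) : R) ^ 2 := by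
    norm_cast
    exact (unit_identities a b).1
  have hy : (b : R) = l ^ 103 * ((a ^ 103 * b⁻¹ ^ 5 : Rˣ) : R) ^ 41 := by
    norm_cast
    exact (unit_identities a b).2.1
  have hz : Ψ (X 2) = l ^ 169 * ((Ψ (X 2) * ((a ^ 28 * b⁻¹ ^ 3 : Rˣ) : R)) *
      ((a ^ 103 * b⁻¹ ^ 5 : Rˣ) : R) ^ 67) := by
    have h1 : (1 : R) = l ^ 169 * ((a ^ 28 * b⁻¹ ^ 3 : Rˣ) : R) *
        ((a ^ 103 * b⁻¹ ^ 5 : Rˣ) : R) ^ 67 := by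
      norm_cast
      exact congrArg Units.val (unit_identities a b).2.2
    linear_combination Ψ (X 2) * h1
  simp only [loc, map_mul, map_pow, aeval_X, algHom_C, algebraMap_eq, map_add,
    map_one, Matrix.cons_val_zero, Matrix.cons_val_one, Matrix.cons_val, deg, ha, hb,
    add_sub_cancel]
  generalize ((a ^ 103 * b⁻¹ ^ 5 : Rˣ) : R) = w at *
  generalize Ψ (X 2) * ((a ^ 28 * b⁻¹ ^ 3 : Rˣ) : R) = v at *
  rw [hx, hy, hz]
  push_cast
  ring

lemma mem_pow_of_loc_mem {R : Type*} [CommRing R] [Algebra K R]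
    (Ψ : MvPolynomial (Fin 3) K →ₐ[K] R) (hx : IsUnit (Ψ (X 0))) (hy : IsUnit (Ψ (X 1)))
    {J : Ideal R} (h₁ : Ψ (X 0) ^ 103 - Ψ (X 1) ^ 5 ∈ J)
    (h₂ : Ψ (X 2) * Ψ (X 0) ^ 28 - Ψ (X 1) ^ 3 ∈ J) {e : ℤ} {n : ℕ}
    {g : MvPolynomial (Fin 3) K} (hg : IsWeightedHomogeneous wz g e)
    (hl : loc K g ∈ idealOfVars (Fin 2) K ^ n) : Ψ g ∈ J ^ n := by
  obtain ⟨a, ha⟩ := hx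
  obtain ⟨b, hb⟩ := hy
  have hbb (k : ℕ) : ((b⁻¹ ^ k : Rˣ) : R) * (b : R) ^ k = 1 := by
    norm_cast; simp
  rw [eval_eq_of_homogeneous Ψ a b ha.symm hb.symm hg]
  refine Ideal.mul_mem_left _ _ ?_
  set θ := aeval (R := K) ![((a ^ 103 * b⁻¹ ^ 5 : Rˣ) : R) - 1,
        Ψ (X 2) * ((a ^ 28 * b⁻¹ ^ 3 : Rˣ) : R) - 1] with hθ
  have hI : (idealOfVars (Fin 2) K).map θ ≤ J := by
    rw [idealOfVars, Ideal.map_span, Ideal.span_le]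
    rintro _ ⟨_, ⟨i, rfl⟩, rfl⟩
    rw [← ha, ← hb] at h₁ h₂
    have e1 : θ (X 0) = ((b⁻¹ ^ 5 : Rˣ) : R) * ((a : R) ^ 103 - (b : R) ^ 5) := by
      simp only [hθ, aeval_X, Matrix.cons_val_zero]
      rw [mul_sub, hbb]
      push_cast
      ring
    have e2 : θ (X 1) = ((b⁻¹ ^ 3 : Rˣ) : R) * (Ψ (X 2) * (a : R) ^ 28 - (b : R) ^ 3) := by
      simp only [hθ, aeval_X, Matrix.cons_val_one, Matrix.cons_val_fin_one]
      rw [mul_sub, hbb]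
      push_cast
      ring
    fin_cases i
    · exact e1 ▸ Ideal.mul_mem_left _ _ h₁
    · exact e2 ▸ Ideal.mul_mem_left _ _ h₂
  have := Ideal.mem_map_of_mem θ hl
  rw [Ideal.map_pow] at this
  exact Ideal.pow_right_mono hI n this

lemma X_zero_notMem : (X 0 : MvPolynomial (Fin 3) K) ∉ pIdeal K 5 103 169 := by
  simp [pIdeal, RingHom.mem_ker, toPoly]

lemma X_one_notMem : (X 1 : MvPolynomial (Fin 3) K) ∉ pIdeal K 5 103 169 := by
  simp [pIdeal, RingHom.mem_ker, toPoly]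

lemma mem_symbPow_of_loc_mem {e : ℤ} {n : ℕ} {g : MvPolynomial (Fin 3) K}
    (hg : IsWeightedHomogeneous wz g e) (hl : loc K g ∈ idealOfVars (Fin 2) K ^ n) :
    g ∈ symbPow (pIdeal K 5 103 169) n := by
  rw [symbPow, Ideal.mem_comap, Ideal.map_pow]
  refine mem_pow_of_loc_mem (IsScalarTower.toAlgHom K (MvPolynomial (Fin 3) K)
    (Localization.AtPrime (pIdeal K 5 103 169))) ?_ ?_ ?_ ?_ hg hl
  · exact IsLocalization.map_units _ (⟨X 0, X_zero_notMem⟩ : (pIdeal K 5 103 169).primeCompl)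
  · exact IsLocalization.map_units _ (⟨X 1, X_one_notMem⟩ : (pIdeal K 5 103 169).primeCompl)
  · rw [← map_pow, ← map_pow, ← map_sub]
    refine Ideal.mem_map_of_mem _ ?_
    simp [pIdeal, RingHom.mem_ker, toPoly, ← pow_mul]
  · rw [← map_pow, ← map_pow, ← map_mul, ← map_sub]
    refine Ideal.mem_map_of_mem _ ?_
    simp [pIdeal, RingHom.mem_ker, toPoly, ← pow_mul, ← pow_add]

/-- A quadratic factor occurring in the parametrization of the negative curve. -/
def q₂ (K : Type*) [Field K] : Polynomial K :=
  -Polynomial.X ^ 2 + 3 * Polynomial.X - 1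

/-- A quartic factor occurring in the parametrization of the negative curve. -/
def q₄ (K : Type*) [Field K] : Polynomial K :=
  -Polynomial.X ^ 4 + 3 * Polynomial.X ^ 3 - 7 * Polynomial.X ^ 2 + 5 * Polynomial.X - 1

/-- The polynomial whose roots are the parameters of the branches through `(1,1,1)`. -/
def r₇ (K : Type*) [Field K] : Polynomial K :=
  Polynomial.X ^ 7 - 4 * Polynomial.X ^ 6 + 16 * Polynomial.X ^ 5 - 35 * Polynomial.X ^ 4
    + 46 * Polynomial.X ^ 3 - 30 * Polynomial.X ^ 2 + 9 * Polynomial.X - 1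

/-- The parametrization of the negative curve. -/
def par (K : Type*) [Field K] : MvPolynomial (Fin 3) K →ₐ[K] Polynomial K :=
  aeval ![Polynomial.X ^ 2, Polynomial.X ^ 39 * q₂ K, Polynomial.X ^ 64 * q₄ K]

lemma par_X_zero : par K (X 0) = Polynomial.X ^ 2 := by simp [par]

lemma par_X_one : par K (X 1) = Polynomial.X ^ 39 * q₂ K := by simp [par]

lemma par_X_two : par K (X 2) = Polynomial.X ^ 64 * q₄ K := by simp [par]

lemma r₇_eq : r₇ K = q₂ K ^ 3 - Polynomial.X ^ 3 * q₄ K := by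
  rw [r₇, q₂, q₄]; ring

lemma q₂_pow_five_sub : q₂ K ^ 5 - Polynomial.X ^ 11 =
    r₇ K * (q₂ K ^ 2 + Polynomial.X ^ 3 * (1 - 2 * Polynomial.X)) := by
  rw [r₇, q₂]; ring

lemma isCoprime_X_q₂ : IsCoprime Polynomial.X (q₂ K) :=
  ⟨3 - Polynomial.X, -1, by rw [q₂]; ring⟩

lemma isCoprime_X_q₄ : IsCoprime Polynomial.X (q₄ K) :=
  ⟨-Polynomial.X ^ 3 + 3 * Polynomial.X ^ 2 - 7 * Polynomial.X + 5, -1, by rw [q₄]; ring⟩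

lemma isCoprime_q₂_q₄ : IsCoprime (q₂ K) (q₄ K) :=
  ⟨169 + (Polynomial.X ^ 2 + 6) * (13 * Polynomial.X - 34), -(13 * Polynomial.X - 34), by
    rw [q₂, q₄]; ring⟩

lemma isCoprime_X_r₇ : IsCoprime Polynomial.X (r₇ K) := by
  rw [r₇_eq, show q₂ K ^ 3 - Polynomial.X ^ 3 * q₄ K
    = q₂ K ^ 3 + Polynomial.X * (-(Polynomial.X ^ 2 * q₄ K)) by ring]
  exact isCoprime_X_q₂.pow_right.add_mul_left_right _

lemma isCoprime_q₂_r₇ : IsCoprime (q₂ K) (r₇ K) := by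
  rw [r₇_eq, show q₂ K ^ 3 - Polynomial.X ^ 3 * q₄ K
    = -(Polynomial.X ^ 3 * q₄ K) + q₂ K * q₂ K ^ 2 by ring]
  exact ((isCoprime_X_q₂.symm.pow_right.mul_right isCoprime_q₂_q₄).neg_right).add_mul_left_right _

lemma isUnit_mk_of_isCoprime {A : Type*} [CommRing A] {a b : A} (h : IsCoprime a b) :
    IsUnit (Ideal.Quotient.mk (Ideal.span {b}) a) := by
  obtain ⟨u, v, huv⟩ := h
  refine IsUnit.of_mul_eq_one (Ideal.Quotient.mk _ u) ?_
  rw [← map_mul, ← map_one (Ideal.Quotient.mk (Ideal.span {b})), Ideal.Quotient.eq,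
    Ideal.mem_span_singleton]
  exact ⟨-v, by linear_combination huv⟩

lemma r₇_pow_dvd {e : ℤ} {n : ℕ} {g : MvPolynomial (Fin 3) K}
    (hg : IsWeightedHomogeneous wz g e) (hl : loc K g ∈ idealOfVars (Fin 2) K ^ n) :
    r₇ K ^ n ∣ par K g := by
  set I := Ideal.span {r₇ K ^ n} with hI
  have hX : IsUnit (Ideal.Quotient.mk I Polynomial.X) :=
    isUnit_mk_of_isCoprime isCoprime_X_r₇.pow_right
  have hq : IsUnit (Ideal.Quotient.mk I (q₂ K)) :=
    isUnit_mk_of_isCoprime isCoprime_q₂_r₇.pow_right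
  have key := mem_pow_of_loc_mem ((Ideal.Quotient.mkₐ K I).comp (par K))
    (J := Ideal.span {Ideal.Quotient.mk I (r₇ K)}) ?_ ?_ ?_ ?_ hg hl
  · rw [Ideal.span_singleton_pow, ← map_pow] at key
    have h0 : Ideal.Quotient.mk I (r₇ K ^ n) = 0 :=
      Ideal.Quotient.eq_zero_iff_mem.mpr (Ideal.mem_span_singleton_self _)
    rw [h0, Ideal.mem_span_singleton, zero_dvd_iff] at key
    exact Ideal.mem_span_singleton.mp (Ideal.Quotient.eq_zero_iff_mem.mp key)
  · simpa [par_X_zero] using hX.pow 2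
  · simpa [par_X_one] using (hX.pow 39).mul hq
  · rw [← map_pow, ← map_pow, ← map_sub]
    simp only [AlgHom.comp_apply, map_sub, map_pow, par_X_zero, par_X_one]
    simp only [← map_pow, ← map_sub]
    rw [Ideal.mem_span_singleton]
    refine map_dvd (Ideal.Quotient.mk I) ⟨-Polynomial.X ^ 195 *
      (q₂ K ^ 2 + Polynomial.X ^ 3 * (1 - 2 * Polynomial.X)), ?_⟩
    linear_combination -Polynomial.X ^ 195 * q₂_pow_five_sub (K := K)
  · rw [← map_pow, ← map_pow, ← map_mul, ← map_sub]
    simp only [AlgHom.comp_apply, map_sub, map_pow, map_mul, par_X_zero, par_X_one, par_X_two]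
    simp only [← map_pow, ← map_mul, ← map_sub]
    rw [Ideal.mem_span_singleton]
    refine map_dvd (Ideal.Quotient.mk I) ⟨-Polynomial.X ^ 117, ?_⟩
    linear_combination Polynomial.X ^ 117 * r₇_eq (K := K)

/-- A term with an integral coefficient. -/
def term (c : ℤ) (i j k : ℕ) : MvPolynomial (Fin 3) K :=
  C (c : K) * (X 0 ^ i * X 1 ^ j * X 2 ^ k)

lemma isWeightedHomogeneous_C_mul_X (c : K) (i j k : ℕ) {e : ℤ}
    (he : 5 * (i : ℤ) + 103 * j + 169 * k = e) :
    IsWeightedHomogeneous wz (C c * (X 0 ^ i * X 1 ^ j * X 2 ^ k)) e := by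
  have h := ((((isWeightedHomogeneous_X K wz 0).pow i).mul
    ((isWeightedHomogeneous_X K wz 1).pow j)).mul
    ((isWeightedHomogeneous_X K wz 2).pow k)).C_mul c
  convert h using 1
  simp [wz, ← he, mul_comm]

lemma isWeightedHomogeneous_term (c : ℤ) (i j k : ℕ) {e : ℤ}
    (he : 5 * (i : ℤ) + 103 * j + 169 * k = e) :
    IsWeightedHomogeneous wz (term c i j k : MvPolynomial (Fin 3) K) e :=
  isWeightedHomogeneous_C_mul_X _ _ _ _ he

lemma par_term (c : ℤ) (i j k : ℕ) :
    par K (term c i j k) = (c : Polynomial K) *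
      (Polynomial.X ^ (2 * i + 39 * j + 64 * k) * q₂ K ^ j * q₄ K ^ k) := by
  simp only [term, map_mul, map_pow, par_X_zero, par_X_one, par_X_two,
    map_intCast]
  ring

/-- The part of the negative curve not involving `z`, divided by `x`. -/
def curveχ (K : Type*) [Field K] : MvPolynomial (Fin 3) K :=
  term (-1) 412 0 0 + term (-4) 309 5 0 + term (-6) 206 10 0 + term (-3) 103 15 0 + term 1 0 20 0

/-- The part of the negative curve involving `z`, divided by `z`. -/
def curveψ (K : Type*) [Field K] : MvPolynomial (Fin 3) K :=
  term 11 338 2 0 + term 32 235 7 0 + term 25 132 12 0 + term (-6) 29 17 0 + term (-43) 263 4 1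
  + term (-66) 160 9 1 + term 16 57 14 1 + term (-4) 291 1 2 + term 43 188 6 2
  + term (-40) 85 11 2 + term 37 216 3 3 + term 94 113 8 3 + term 1 10 13 3 + term (-1) 244 0 4
  + term (-98) 141 5 4 + term 1 38 10 4 + term (-2) 169 2 5 + term (-26) 66 7 5 + term 48 94 4 6
  + term (-3) 122 1 7 + term 4 19 6 7 + term (-12) 47 3 8 + term 1 75 0 9 + term 1 0 2 10

/-- The equation of the negative curve, of degree `2065` and multiplicity `7`. -/
def curve (K : Type*) [Field K] : MvPolynomial (Fin 3) K :=
  X 0 * curveχ K + X 2 * curveψ K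

lemma isWeightedHomogeneous_curveχ : IsWeightedHomogeneous wz (curveχ K) 2060 := by
  rw [curveχ]
  repeat' apply IsWeightedHomogeneous.add
  all_goals exact isWeightedHomogeneous_term _ _ _ _ (by norm_num)

lemma isWeightedHomogeneous_curveψ : IsWeightedHomogeneous wz (curveψ K) 1896 := by
  rw [curveψ]
  repeat' apply IsWeightedHomogeneous.add
  all_goals exact isWeightedHomogeneous_term _ _ _ _ (by norm_num)

lemma isWeightedHomogeneous_X_mul (i : Fin 3) {g : MvPolynomial (Fin 3) K} {e : ℤ}
    (hg : IsWeightedHomogeneous wz g e) : IsWeightedHomogeneous wz (X i * g) (wz i + e) :=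
  (isWeightedHomogeneous_X K wz i).mul hg

lemma isWeightedHomogeneous_curve : IsWeightedHomogeneous wz (curve K) 2065 :=
  (isWeightedHomogeneous_X_mul 0 isWeightedHomogeneous_curveχ).add
    (isWeightedHomogeneous_X_mul 2 isWeightedHomogeneous_curveψ)

lemma curve_relation {A : Type*} [CommRing A] (s a b : A) (ha : a = -s ^ 2 + 3 * s - 1)
    (hb : b = -s ^ 4 + 3 * s ^ 3 - 7 * s ^ 2 + 5 * s - 1) :
    (-1) * (s ^ 44 * a ^ 0 * b ^ 0) + (-4) * (s ^ 33 * a ^ 5 * b ^ 0)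
    + (-6) * (s ^ 22 * a ^ 10 * b ^ 0) + (-3) * (s ^ 11 * a ^ 15 * b ^ 0)
    + 1 * (s ^ 0 * a ^ 20 * b ^ 0) + 11 * (s ^ 36 * a ^ 2 * b ^ 1) + 32 * (s ^ 25 * a ^ 7 * b ^ 1)
    + 25 * (s ^ 14 * a ^ 12 * b ^ 1) + (-6) * (s ^ 3 * a ^ 17 * b ^ 1)
    + (-43) * (s ^ 28 * a ^ 4 * b ^ 2) + (-66) * (s ^ 17 * a ^ 9 * b ^ 2)
    + 16 * (s ^ 6 * a ^ 14 * b ^ 2) + (-4) * (s ^ 31 * a ^ 1 * b ^ 3)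
    + 43 * (s ^ 20 * a ^ 6 * b ^ 3) + (-40) * (s ^ 9 * a ^ 11 * b ^ 3)
    + 37 * (s ^ 23 * a ^ 3 * b ^ 4) + 94 * (s ^ 12 * a ^ 8 * b ^ 4) + 1 * (s ^ 1 * a ^ 13 * b ^ 4)
    + (-1) * (s ^ 26 * a ^ 0 * b ^ 5) + (-98) * (s ^ 15 * a ^ 5 * b ^ 5)
    + 1 * (s ^ 4 * a ^ 10 * b ^ 5) + (-2) * (s ^ 18 * a ^ 2 * b ^ 6)
    + (-26) * (s ^ 7 * a ^ 7 * b ^ 6) + 48 * (s ^ 10 * a ^ 4 * b ^ 7)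
    + (-3) * (s ^ 13 * a ^ 1 * b ^ 8) + 4 * (s ^ 2 * a ^ 6 * b ^ 8)
    + (-12) * (s ^ 5 * a ^ 3 * b ^ 9) + 1 * (s ^ 8 * a ^ 0 * b ^ 10)
    + 1 * (s ^ 0 * a ^ 2 * b ^ 11)
    = 0 := by
  rw [ha, hb]
  ring

lemma par_curve : par K (curve K) = 0 := by
  simp only [curve, curveχ, curveψ, map_add, map_mul, par_X_zero, par_X_two, par_term]
  have h := curve_relation (Polynomial.X : Polynomial K) (q₂ K) (q₄ K) rfl rfl
  push_cast
  linear_combination Polynomial.X ^ 782 * h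

lemma loc_curve_notMem [CharZero K] : loc K (curve K) ∉ idealOfVars (Fin 2) K ^ 8 := by
  intro h
  set θ : MvPolynomial (Fin 2) K →ₐ[K] Polynomial K := aeval ![0, Polynomial.X] with hθ
  have hI : (idealOfVars (Fin 2) K).map θ ≤ Ideal.span {Polynomial.X} := by
    rw [idealOfVars, Ideal.map_span, Ideal.span_le]
    rintro _ ⟨_, ⟨i, rfl⟩, rfl⟩
    fin_cases i
    · simp [hθ]
    · simp [hθ]
  have h1 := Ideal.mem_map_of_mem θ h
  rw [Ideal.map_pow] at h1
  have h2 := Ideal.pow_right_mono hI 8 h1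
  rw [Ideal.span_singleton_pow, Ideal.mem_span_singleton] at h2
  have h3 (c : ℤ) (i j k : ℕ) :
      θ (loc K (term c i j k)) = (c : Polynomial K) * (1 + Polynomial.X) ^ k := by
    simp [hθ, loc, term]
  have h4 (t : Polynomial K) : θ (loc K (curve K)) = Polynomial.X ^ 7 *
      (13 + 29 * (1 + Polynomial.X) + 23 * (1 + Polynomial.X) ^ 2 + 8 * (1 + Polynomial.X) ^ 3
        + (1 + Polynomial.X) ^ 4) := by
    simp only [curve, curveχ, curveψ, map_add, map_mul, h3]
    simp only [hθ, loc, aeval_X, Matrix.cons_val_zero, Matrix.cons_val, map_mul, map_pow, map_add,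
      map_one]
    push_cast
    ring
  rw [h4 0, pow_succ, mul_dvd_mul_iff_left (pow_ne_zero _ Polynomial.X_ne_zero),
    Polynomial.X_dvd_iff, Polynomial.coeff_zero_eq_eval_zero] at h2
  norm_num at h2

lemma X_zero_not_dvd_curve : ¬ (X 0 : MvPolynomial (Fin 3) K) ∣ curve K := by
  intro h
  have h1 := map_dvd (aeval (R := K) ![(0 : K), 1, 1]) h
  simp [curve, curveχ, curveψ, term] at h1

lemma q₄_dvd_par_curveχ : q₄ K ∣ par K (curveχ K) := by
  have h := par_curve (K := K)
  rw [curve, map_add, map_mul, map_mul, par_X_zero, par_X_two] at h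
  refine (isCoprime_X_q₄.pow_left (m := 2)).symm.dvd_of_dvd_mul_left
    ⟨-(Polynomial.X ^ 64 * par K (curveψ K)), ?_⟩
  linear_combination h

/-- Existence of a division of `g`, homogeneous of degree `e`, by `z` and `curveχ`. -/
def HasDivision (e : ℤ) (g : MvPolynomial (Fin 3) K) : Prop :=
  ∃ a b r : MvPolynomial (Fin 3) K, IsWeightedHomogeneous wz a (e - 2060) ∧
    IsWeightedHomogeneous wz b (e - 169) ∧ IsWeightedHomogeneous wz r e ∧
    (∀ d ∈ r.support, d 2 = 0 ∧ d 1 < 20) ∧ g = curveχ K * a + r + X 2 * b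

lemma HasDivision.add {e : ℤ} {g g' : MvPolynomial (Fin 3) K} (h : HasDivision e g)
    (h' : HasDivision e g') : HasDivision e (g + g') := by
  obtain ⟨a, b, r, ha, hb, hr, hs, rfl⟩ := h
  obtain ⟨a', b', r', ha', hb', hr', hs', rfl⟩ := h'
  refine ⟨a + a', b + b', r + r', ha.add ha', hb.add hb', hr.add hr', fun d hd => ?_, by ring⟩
  classical
  exact (Finset.mem_union.mp (support_add hd)).elim (hs d) (hs' d)

lemma hasDivision_zero (e : ℤ) : HasDivision e (0 : MvPolynomial (Fin 3) K) :=
  ⟨0, 0, 0, isWeightedHomogeneous_zero _ _ _, isWeightedHomogeneous_zero _ _ _,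
    isWeightedHomogeneous_zero _ _ _, by simp, by simp⟩

lemma hasDivision_monomial (e : ℤ) (j : ℕ) : ∀ (c : K) (i k : ℕ),
    5 * (i : ℤ) + 103 * j + 169 * k = e →
      HasDivision e (C c * (X 0 ^ i * X 1 ^ j * X 2 ^ k)) := by
  induction j using Nat.strong_induction_on with
  | _ j ih =>
  intro c i k he
  rcases k with _ | k
  · by_cases hj : j < 20
    · refine ⟨0, 0, _, isWeightedHomogeneous_zero _ _ _, isWeightedHomogeneous_zero _ _ _,
        isWeightedHomogeneous_C_mul_X c i j 0 he, fun d hd => ?_, by simp⟩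
      have h1 : C c * (X 0 ^ i * X 1 ^ j * X 2 ^ 0) = (monomial
          (Finsupp.single 0 i + Finsupp.single 1 j) c : MvPolynomial (Fin 3) K) := by
        rw [monomial_eq_C_mul]
        simp
      rw [h1] at hd
      have h2 := Finset.mem_singleton.mp (support_monomial_subset hd)
      subst h2
      simpa using hj
    · obtain ⟨l, rfl⟩ : ∃ l, j = l + 20 := ⟨j - 20, by omega⟩
      push_cast at he
      have h0 : HasDivision e (curveχ K * (C c * (X 0 ^ i * X 1 ^ l * X 2 ^ 0))) :=
        ⟨_, 0, 0, isWeightedHomogeneous_C_mul_X c i l 0 (by push_cast; linarith),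
          isWeightedHomogeneous_zero _ _ _, isWeightedHomogeneous_zero _ _ _, by simp,
          by ring⟩
      have h1 := ih (l + 15) (by omega) (3 * c) (i + 103) 0 (by push_cast; linarith)
      have h2 := ih (l + 10) (by omega) (6 * c) (i + 206) 0 (by push_cast; linarith)
      have h3 := ih (l + 5) (by omega) (4 * c) (i + 309) 0 (by push_cast; linarith)
      have h4 := ih l (by omega) c (i + 412) 0 (by push_cast; linarith)
      convert (((h0.add h1).add h2).add h3).add h4 using 1
      simp only [curveχ, term, map_mul, Int.cast_neg, Int.cast_ofNat, Int.cast_one, map_neg,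
        map_one, map_ofNat]
      ring
  · exact ⟨0, _, 0, isWeightedHomogeneous_zero _ _ _,
      isWeightedHomogeneous_C_mul_X c i j k (by push_cast at he; linarith),
      isWeightedHomogeneous_zero _ _ _, by simp, by ring⟩

lemma hasDivision_of_isWeightedHomogeneous {e : ℤ} {g : MvPolynomial (Fin 3) K}
    (hg : IsWeightedHomogeneous wz g e) : HasDivision e g := by
  rw [g.as_sum]
  refine Finset.sum_induction _ (HasDivision e) (fun _ _ => HasDivision.add)
    (hasDivision_zero e) fun d hd => ?_
  have h := hg (mem_support_iff.mp hd)
  rw [weight_wz] at h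
  rw [monomial_eq_C_mul]
  exact hasDivision_monomial e _ _ _ _ h

lemma eq_zero_of_q₄_dvd {c₀ c₁ c₂ c₃ : K}
    (h : q₄ K ∣ Polynomial.C c₀ * (Polynomial.X ^ 11) ^ 3
      + Polynomial.C c₁ * ((Polynomial.X ^ 11) ^ 2 * q₂ K ^ 5)
      + Polynomial.C c₂ * (Polynomial.X ^ 11 * (q₂ K ^ 5) ^ 2)
      + Polynomial.C c₃ * (q₂ K ^ 5) ^ 3) : c₀ = 0 ∧ c₁ = 0 ∧ c₂ = 0 ∧ c₃ = 0 := by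
  set s : Polynomial K := Polynomial.X with hs
  set U : Polynomial K := -308 + 1421 * s - 1548 * s ^ 2 + 56 * s ^ 3 with hU
  set V : Polynomial K := 199 - 976 * s + 1265 * s ^ 2 - 317 * s ^ 3 with hV
  set U2 : Polynomial K := -1946736 + 9496632 * s - 12141367 * s ^ 2 + 2854344 * s ^ 3 with hU2
  set V2 : Polynomial K := 25644 + 181880 * s - 1244857 * s ^ 2 + 1452671 * s ^ 3 with hV2
  let mk := Ideal.Quotient.mk (Ideal.span {q₄ K})
  have mk_eq {a b : Polynomial K} (q : Polynomial K) (hab : a = b + q₄ K * q) : mk a = mk b := by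
    rw [Ideal.Quotient.eq, Ideal.mem_span_singleton]
    exact ⟨q, by rw [hab]; ring⟩
  have hu : mk (s ^ 11) = mk U := mk_eq
    (-308 - 119 * s + 13 * s ^ 2 + 30 * s ^ 3 + 10 * s ^ 4 - 2 * s ^ 5 - 3 * s ^ 6 - s ^ 7) (by
      rw [hU, q₄]; ring)
  have hv : mk (q₂ K ^ 5) = mk V := mk_eq
    (200 + 9 * s + 5 * s ^ 2 - 85 * s ^ 3 + 52 * s ^ 4 - 12 * s ^ 5 + s ^ 6) (by
      rw [hV, q₂, q₄]; ring)
  have hu2 : mk U ^ 2 = mk U2 := by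
    rw [← map_pow]
    exact mk_eq (-2041600 + 163968 * s - 3136 * s ^ 2) (by rw [hU, hU2, q₄]; ring)
  have hv2 : mk V ^ 2 = mk V2 := by
    rw [← map_pow]
    exact mk_eq (-13957 + 500543 * s - 100489 * s ^ 2) (by rw [hV, hV2, q₄]; ring)
  have h0 : mk (Polynomial.C c₀ * (U2 * U) + Polynomial.C c₁ * (U2 * V)
      + Polynomial.C c₂ * (V2 * U) + Polynomial.C c₃ * (V2 * V)) = 0 := by
    have h1 := Ideal.Quotient.eq_zero_iff_mem.mpr (Ideal.mem_span_singleton.mpr h)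
    simp only [map_add, map_mul, map_pow] at h1
    change _ * (mk s ^ 11) ^ 3 + _ * ((mk s ^ 11) ^ 2 * mk (q₂ K) ^ 5)
      + _ * (mk s ^ 11 * (mk (q₂ K) ^ 5) ^ 2) + _ * (mk (q₂ K) ^ 5) ^ 3 = 0 at h1
    rw [map_pow] at hu hv
    rw [hu, hv] at h1
    rw [← h1]
    simp only [map_add, map_mul, ← hu2, ← hv2]
    ring
  have h2 := Ideal.mem_span_singleton.mp (Ideal.Quotient.eq_zero_iff_mem.mp h0)
  set R : Polynomial K :=
      Polynomial.C (-7807438980 * c₀ + 198679478 * c₁ + 2783273189 * c₂ - 2720441921 * c₃)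
    + Polynomial.C (40962805100 * c₀ - 3885632961 * c₁ - 11901038649 * c₂ + 12788132598 * c₃) * s
    + Polynomial.C (-61855832864 * c₀ + 14585307512 * c₁ + 9687031875 * c₂ - 14757328780 * c₃)
      * s ^ 2
    + Polynomial.C (25410872217 * c₀ - 14449573111 * c₁ + 4057540420 * c₂ + 1644854168 * c₃)
      * s ^ 3 with hR
  have h3 : q₄ K ∣ R := by
    have h4 : R = Polynomial.C c₀ * (U2 * U) + Polynomial.C c₁ * (U2 * V)
        + Polynomial.C c₂ * (V2 * U) + Polynomial.C c₃ * (V2 * V) - q₄ K * (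
          Polynomial.C c₀ * (-8407033668 + 4618911272 * s - 159843264 * s ^ 2)
        + Polynomial.C c₁ * (586079942 - 4745077355 * s + 904827048 * s ^ 2)
        + Polynomial.C c₂ * (2791171541 + 2074397972 * s - 81349576 * s ^ 2)
        + Polynomial.C c₃ * (-2725545077 - 850758363 * s + 460496707 * s ^ 2)) := by
      rw [hR, hU, hV, hU2, hV2, q₄]
      simp only [map_add, map_sub, map_mul, map_neg, map_ofNat]
      ring
    rw [h4]
    exact dvd_sub h2 (dvd_mul_right _ _)
  have hdeg : R = 0 := by
    refine Polynomial.eq_zero_of_dvd_of_natDegree_lt h3 ?_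
    have h5 : (q₄ K).natDegree = 4 := by rw [q₄]; compute_degree!
    have h6 : R.natDegree ≤ 3 := by rw [hR, hs]; compute_degree
    omega
  have e0 := congrArg (Polynomial.coeff · 0) hdeg
  have e1 := congrArg (Polynomial.coeff · 1) hdeg
  have e2 := congrArg (Polynomial.coeff · 2) hdeg
  have e3 := congrArg (Polynomial.coeff · 3) hdeg
  simp only [hR, hs, Polynomial.coeff_add, Polynomial.coeff_C_mul, Polynomial.coeff_C,
    Polynomial.coeff_X_pow, Polynomial.coeff_X, Polynomial.coeff_zero] at e0 e1 e2 e3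
  norm_num at e0 e1 e2 e3
  refine ⟨?_, ?_, ?_, ?_⟩
  · linear_combination 3917725016720034 * e0 + 1348537326447569 * e1 + 464185953090393 * e2
      + 159779484648069 * e3
  · linear_combination 8914814778047398 * e0 + 3068607529964943 * e1 + 1056258868803459 * e2
      + 363579502119748 * e3
  · linear_combination 8132823699919788 * e0 + 2799434948124704 * e1 + 963605792782871 * e2
      + 331686980094352 * e3
  · linear_combination -2271814023792745 * e0 - 781991078127610 * e1 - 269172581840239 * e2
      - 92653076020588 * e3

lemma remainder_eq_zero {e : ℤ} {r : MvPolynomial (Fin 3) K} (hr : IsWeightedHomogeneous wz r e)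
    (hs : ∀ d ∈ r.support, d 2 = 0 ∧ d 1 < 20) (hq : q₄ K ∣ par K r) : r = 0 := by
  by_contra hr0
  obtain ⟨d₀, hd₀⟩ := Finset.nonempty_iff_ne_empty.mpr (mt support_eq_empty.mp hr0)
  have hw : ∀ d ∈ r.support, 5 * (d 0 : ℤ) + 103 * d 1 = e := fun d hd => by
    have := hr (mem_support_iff.mp hd)
    rw [weight_wz, (hs d hd).1] at this
    simpa using this
  set G : ℕ → Polynomial K := fun q => (Polynomial.X ^ 11) ^ (3 - q) * (q₂ K ^ 5) ^ q with hG
  set j := d₀ 1 % 5 with hj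
  set A := 2 * d₀ 0 + 206 * (d₀ 1 / 5) + 39 * j with hA
  have hpar : Polynomial.X ^ 33 * par K r =
      (Polynomial.X ^ A * q₂ K ^ j) * ∑ d ∈ r.support, Polynomial.C (coeff d r) * G (d 1 / 5) := by
    conv_lhs => rw [r.as_sum]
    rw [map_sum, Finset.mul_sum, Finset.mul_sum]
    refine Finset.sum_congr rfl fun d hd => ?_
    have h1 := hw d hd
    have h2 := hw d₀ hd₀
    obtain ⟨h3, h4⟩ := hs d hd
    have h5 : d 1 = j + 5 * (d 1 / 5) := by omega
    have h6 : 33 + 2 * d 0 + 39 * d 1 = A + 11 * (3 - d 1 / 5) := by omega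
    rw [monomial_eq_C_mul]
    simp only [map_mul, map_pow, par_X_zero, par_X_one, h3, pow_zero, mul_one, algHom_C,
      Polynomial.algebraMap_eq, hG]
    calc _ = Polynomial.C (coeff d r) * (Polynomial.X ^ (33 + 2 * d 0 + 39 * d 1)
            * q₂ K ^ d 1) := by ring
      _ = Polynomial.C (coeff d r) * (Polynomial.X ^ (A + 11 * (3 - d 1 / 5))
            * q₂ K ^ (j + 5 * (d 1 / 5))) := by rw [h6, ← h5]
      _ = _ := by ring
  set γ : ℕ → K := fun q => ∑ d ∈ r.support with d 1 / 5 = q, coeff d r with hγ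
  have hfib : ∑ d ∈ r.support, Polynomial.C (coeff d r) * G (d 1 / 5) =
      ∑ q ∈ Finset.range 4, Polynomial.C (γ q) * G q := by
    rw [← Finset.sum_fiberwise_of_maps_to (t := Finset.range 4) (g := fun d => d 1 / 5)
      fun d hd => Finset.mem_range.mpr (by have := (hs d hd).2; omega)]
    refine Finset.sum_congr rfl fun q _ => ?_
    rw [hγ, map_sum, Finset.sum_mul]
    refine Finset.sum_congr rfl fun d hd => ?_
    rw [(Finset.mem_filter.mp hd).2]
  have hdvd : q₄ K ∣ ∑ q ∈ Finset.range 4, Polynomial.C (γ q) * G q := by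
    rw [← hfib]
    have h : IsCoprime (q₄ K) (Polynomial.X ^ A * q₂ K ^ j) :=
      isCoprime_X_q₄.symm.pow_right.mul_right isCoprime_q₂_q₄.symm.pow_right
    exact h.dvd_of_dvd_mul_left (hpar ▸ hq.mul_left _)
  have h0 : γ 0 = 0 ∧ γ 1 = 0 ∧ γ 2 = 0 ∧ γ 3 = 0 := by
    refine eq_zero_of_q₄_dvd ?_
    simpa [Finset.sum_range_succ, hG] using hdvd
  have h1 : γ (d₀ 1 / 5) = coeff d₀ r := by
    rw [hγ]
    refine Finset.sum_eq_single_of_mem d₀ (Finset.mem_filter.mpr ⟨hd₀, rfl⟩) fun d hd hne => ?_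
    obtain ⟨hd, hdq⟩ := Finset.mem_filter.mp hd
    have h1 := hw d hd
    have h2 := hw d₀ hd₀
    have h3 := hs d hd
    have h4 := hs d₀ hd₀
    refine absurd (Finsupp.ext fun i => ?_) hne
    fin_cases i
    · change d 0 = d₀ 0; omega
    · change d 1 = d₀ 1; omega
    · change d 2 = d₀ 2; omega
  have h2 : d₀ 1 / 5 < 4 := by have := (hs d₀ hd₀).2; omega
  refine mem_support_iff.mp hd₀ (h1 ▸ ?_)
  generalize d₀ 1 / 5 = q at h2
  interval_cases q
  exacts [h0.1, h0.2.1, h0.2.2.1, h0.2.2.2]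

lemma eq_zero_of_weight_neg {e : ℤ} {g : MvPolynomial (Fin 3) K}
    (hg : IsWeightedHomogeneous wz g e) (he : e < 0) : g = 0 := by
  by_contra h
  obtain ⟨d, hd⟩ := Finset.nonempty_iff_ne_empty.mpr (mt support_eq_empty.mp h)
  have := hg (mem_support_iff.mp hd)
  rw [weight_wz_eq_deg] at this
  omega

lemma weightedHomogeneousComponent_mul {f : MvPolynomial (Fin 3) K} {m : ℤ}
    (hf : IsWeightedHomogeneous wz f m) (n : ℤ) (h : MvPolynomial (Fin 3) K) :
    weightedHomogeneousComponent wz (m + n) (f * h) =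
      f * weightedHomogeneousComponent wz n h := by
  induction h using MvPolynomial.induction_on' with
  | add p q hp hq => simp [mul_add, hp, hq]
  | monomial u c =>
    have hu := isWeightedHomogeneous_monomial wz u c rfl
    rw [weightedHomogeneousComponent_of_mem (hf.mul hu), weightedHomogeneousComponent_of_mem hu]
    simp only [add_right_inj, mul_ite, mul_zero]

lemma exists_pow_mul_eq_curve_mul (N : ℕ) : ∀ (e : ℤ), e < N → ∀ g : MvPolynomial (Fin 3) K,
    IsWeightedHomogeneous wz g e → par K g = 0 →
      ∃ (k : ℕ) (h : MvPolynomial (Fin 3) K), X 0 ^ k * g = curve K * h := by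
  induction N with
  | zero => exact fun e he g hg _ => ⟨0, 0, by simp [eq_zero_of_weight_neg hg (by simpa using he)]⟩
  | succ N ih =>
    intro e he g hg h0
    obtain ⟨a, b, r, ha, hb, hr, hs, rfl⟩ := hasDivision_of_isWeightedHomogeneous hg
    have hr0 : r = 0 := by
      refine remainder_eq_zero hr hs ?_
      rw [map_add, map_add, map_mul, map_mul, par_X_two] at h0
      rw [show par K r = -(par K (curveχ K) * par K a
        + q₄ K * (Polynomial.X ^ 64 * par K b)) by linear_combination h0]
      exact (dvd_add (q₄_dvd_par_curveχ.mul_right _) (dvd_mul_right _ _)).neg_right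
    subst hr0
    have hg' : X 0 * (curveχ K * a + 0 + X 2 * b) =
        curve K * a + X 2 * (X 0 * b - curveψ K * a) := by
      rw [curve]; ring
    have hhom : IsWeightedHomogeneous wz (X 0 * b - curveψ K * a) (5 + (e - 169)) := by
      have h := isWeightedHomogeneous_curveψ.mul ha
      rw [show (1896 : ℤ) + (e - 2060) = 5 + (e - 169) by ring] at h
      exact (isWeightedHomogeneous_X_mul 0 hb).sub h
    have hpar : par K (X 0 * b - curveψ K * a) = 0 := by
      have := congrArg (par K) hg'
      rw [map_mul, h0, mul_zero, map_add, map_mul, par_curve, zero_mul, zero_add, map_mul,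
        par_X_two] at this
      refine (mul_eq_zero.mp this.symm).resolve_left (mul_ne_zero (by simp) ?_)
      intro h
      have := isCoprime_X_q₄ (K := K)
      rw [h, isCoprime_zero_right] at this
      exact Polynomial.not_isUnit_X this
    obtain ⟨k, h, hk⟩ := ih _ (by push_cast at he; linarith) _ hhom hpar
    refine ⟨k + 1, X 0 ^ k * a + X 2 * h, ?_⟩
    rw [pow_succ, mul_assoc, hg']
    linear_combination X 2 * hk

lemma exists_eq_curve_mul {e : ℤ} {g : MvPolynomial (Fin 3) K}
    (hg : IsWeightedHomogeneous wz g (2065 + e)) (h0 : par K g = 0) :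
    ∃ h : MvPolynomial (Fin 3) K, IsWeightedHomogeneous wz h e ∧ g = curve K * h := by
  obtain ⟨k, h, hk⟩ := exists_pow_mul_eq_curve_mul ((2065 + e).toNat + 1) (2065 + e)
    (by push_cast; have := Int.self_le_toNat (2065 + e); linarith) g hg h0
  have hX : Prime (X 0 : MvPolynomial (Fin 3) K) := X_prime
  obtain ⟨h', rfl⟩ := hX.pow_dvd_of_dvd_mul_left k X_zero_not_dvd_curve ⟨g, hk.symm⟩
  have hg' : g = curve K * h' := by
    refine mul_left_cancel₀ (pow_ne_zero k hX.ne_zero) ?_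
    rw [hk]; ring
  refine ⟨weightedHomogeneousComponent wz e h',
    weightedHomogeneousComponent_mem _ _ _, ?_⟩
  rw [← weightedHomogeneousComponent_mul isWeightedHomogeneous_curve, ← hg',
    hg.weightedHomogeneousComponent_same]

lemma par_monomial (d : Fin 3 →₀ ℕ) (c : K) :
    par K (monomial d c) = Polynomial.C c *
      (Polynomial.X ^ (2 * d 0 + 39 * d 1 + 64 * d 2) * q₂ K ^ d 1 * q₄ K ^ d 2) := by
  rw [monomial_eq_C_mul]
  simp only [map_mul, map_pow, par_X_zero, par_X_one, par_X_two, algHom_C,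
    Polynomial.algebraMap_eq]
  ring

lemma natDegree_q₂ : (q₂ K).natDegree = 2 := by rw [q₂]; compute_degree!

lemma natDegree_q₄ : (q₄ K).natDegree = 4 := by rw [q₄]; compute_degree!

lemma natDegree_r₇ : (r₇ K).natDegree = 7 := by rw [r₇]; compute_degree!

lemma q₂_ne_zero : q₂ K ≠ 0 := fun h => by simpa [h] using natDegree_q₂ (K := K)

lemma q₄_ne_zero : q₄ K ≠ 0 := fun h => by simpa [h] using natDegree_q₄ (K := K)

lemma r₇_ne_zero : r₇ K ≠ 0 := fun h => by simpa [h] using natDegree_r₇ (K := K)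

lemma dvd_par {g : MvPolynomial (Fin 3) K} {u : Polynomial K}
    (h : ∀ d ∈ g.support, u ∣
      Polynomial.X ^ (2 * d 0 + 39 * d 1 + 64 * d 2) * q₂ K ^ d 1 * q₄ K ^ d 2) :
    u ∣ par K g := by
  rw [g.as_sum, map_sum]
  exact Finset.dvd_sum fun d hd => by
    rw [par_monomial]
    exact (h d hd).mul_left _

lemma natDegree_par_le {g : MvPolynomial (Fin 3) K} {m : ℕ}
    (h : ∀ d ∈ g.support, 2 * d 0 + 41 * d 1 + 68 * d 2 ≤ m) : (par K g).natDegree ≤ m := by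
  rw [g.as_sum, map_sum]
  refine Polynomial.natDegree_sum_le_of_forall_le _ _ fun d hd => ?_
  rw [par_monomial]
  refine (Polynomial.natDegree_C_mul_le _ _).trans ((le_of_eq ?_).trans (h d hd))
  rw [Polynomial.natDegree_mul (mul_ne_zero (by simp) (pow_ne_zero _ q₂_ne_zero))
    (pow_ne_zero _ q₄_ne_zero), Polynomial.natDegree_mul (by simp) (pow_ne_zero _ q₂_ne_zero),
    Polynomial.natDegree_X_pow, Polynomial.natDegree_pow, Polynomial.natDegree_pow,
    natDegree_q₂, natDegree_q₄]
  ring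

lemma weight_eq {e : ℕ} {g : MvPolynomial (Fin 3) K} (hg : IsWeightedHomogeneous wz g e)
    {d : Fin 3 →₀ ℕ} (hd : d ∈ g.support) : 5 * d 0 + 103 * d 1 + 169 * d 2 = e := by
  have := hg (mem_support_iff.mp hd)
  rw [weight_wz_eq_deg] at this
  exact_mod_cast this

/-- Cofactor extraction: the quotient of `par K g` by `ρ = s ^ A * r₇ ^ n`, with another known
factor `u`, has the expected degree. -/
lemma exists_par_eq {g : MvPolynomial (Fin 3) K} {A n m : ℕ} {u : Polynomial K}
    (hu : IsCoprime (r₇ K) u) (hu0 : u ≠ 0)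
    (h₁ : ∀ d ∈ g.support, Polynomial.X ^ A * u ∣
      Polynomial.X ^ (2 * d 0 + 39 * d 1 + 64 * d 2) * q₂ K ^ d 1 * q₄ K ^ d 2)
    (h₂ : ∀ d ∈ g.support, 2 * d 0 + 41 * d 1 + 68 * d 2 ≤ m) (h₃ : r₇ K ^ n ∣ par K g) :
    ∃ P : Polynomial K, par K g = Polynomial.X ^ A * r₇ K ^ n * u * P ∧
      (P ≠ 0 → A + 7 * n + u.natDegree + P.natDegree ≤ m) := by
  have hco : IsCoprime (Polynomial.X ^ A * u) (r₇ K ^ n) :=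
    (IsCoprime.mul_left isCoprime_X_r₇.pow_left hu.symm).pow_right
  obtain ⟨P, hP⟩ := hco.mul_dvd (dvd_par h₁) h₃
  refine ⟨P, by rw [hP]; ring, fun hP0 => ?_⟩
  have h4 := natDegree_par_le h₂
  rw [hP, Polynomial.natDegree_mul (mul_ne_zero (mul_ne_zero (by simp) hu0)
    (pow_ne_zero _ r₇_ne_zero)) hP0, Polynomial.natDegree_mul (mul_ne_zero (by simp) hu0)
    (pow_ne_zero _ r₇_ne_zero), Polynomial.natDegree_mul (by simp) hu0,
    Polynomial.natDegree_X_pow, Polynomial.natDegree_pow, natDegree_r₇] at h4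
  linarith

/-- The Euler-type operators `X_i ∂_i`. -/
def euler (i : Fin 3) (g : MvPolynomial (Fin 3) K) : MvPolynomial (Fin 3) K :=
  X i * pderiv i g

lemma coeff_euler (i : Fin 3) (g : MvPolynomial (Fin 3) K) (d : Fin 3 →₀ ℕ) :
    coeff d (euler i g) = d i * coeff d g := by
  induction g using MvPolynomial.induction_on' with
  | add p q hp hq => rw [euler, map_add, mul_add, coeff_add, ← euler, ← euler, hp, hq, coeff_add,
      mul_add]
  | monomial u c =>
    rw [euler, X_mul_pderiv_monomial, coeff_smul, coeff_monomial]
    split_ifs with h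
    · simp [h]
    · simp

lemma euler_relation {e : ℕ} {g : MvPolynomial (Fin 3) K} (hg : IsWeightedHomogeneous wz g e) :
    5 * euler 0 g + 103 * euler 1 g + 169 * euler 2 g = C (e : K) * g := by
  ext d
  rw [← map_ofNat C 5, ← map_ofNat C 103, ← map_ofNat C 169]
  simp only [coeff_add, coeff_C_mul, coeff_euler]
  by_cases hd : d ∈ g.support
  · rw [← weight_eq hg hd]
    push_cast
    ring
  · rw [notMem_support_iff.mp hd]
    ring

lemma derivative_par (g : MvPolynomial (Fin 3) K) :
    Polynomial.derivative (par K g) = ∑ i, par K (pderiv i g) *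
      Polynomial.derivative (par K (X i)) := by
  induction g using MvPolynomial.induction_on with
  | C a => simp
  | add p q hp hq => simp only [map_add, hp, hq, add_mul, Finset.sum_add_distrib]
  | mul_X p i hp =>
    have h (j : Fin 3) : par K (pderiv j (p * X i)) * Polynomial.derivative (par K (X j)) =
        (if j = i then par K p * Polynomial.derivative (par K (X i)) else 0) +
          par K (pderiv j p) * Polynomial.derivative (par K (X j)) * par K (X i) := by
      rw [Derivation.leibniz, smul_eq_mul, smul_eq_mul, map_add, map_mul, map_mul, add_mul]
      split_ifs with hj
      · subst hj
        rw [pderiv_X_self, map_one]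
        ring
      · rw [pderiv_X_of_ne (Ne.symm hj), map_zero]
        ring
    rw [map_mul, Polynomial.derivative_mul, hp, Finset.sum_congr rfl fun j _ => h j,
      Finset.sum_add_distrib, Finset.sum_ite_eq' Finset.univ i, if_pos (Finset.mem_univ i),
      ← Finset.sum_mul, add_comm]

lemma loc_euler_mem {e : ℕ} {n : ℕ} {g : MvPolynomial (Fin 3) K}
    (hg : IsWeightedHomogeneous wz g e) (hl : loc K g ∈ idealOfVars (Fin 2) K ^ n) (i : Fin 3) :
    IsWeightedHomogeneous wz (euler i g) e ∧
      loc K (euler i g) ∈ idealOfVars (Fin 2) K ^ (n - 1) := by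
  have h1 : IsWeightedHomogeneous wz (euler i g) e := fun d hd => by
    rw [coeff_euler] at hd
    exact hg (right_ne_zero_of_mul hd)
  refine ⟨h1, ?_⟩
  have h2 : euler i g ∈ symbPow (pIdeal K 5 103 169) (n - 1) :=
    Ideal.mul_mem_left _ _ (derivation_mem_symbPow ((pderiv i).restrictScalars ℤ) _ _
      (mem_symbPow_of_loc_mem hg hl))
  have h3 := loc_component_mem h2 e
  rwa [h1.weightedHomogeneousComponent_same] at h3

lemma exists_par_eq_of_isWeightedHomogeneous {e n : ℕ} {g : MvPolynomial (Fin 3) K}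
    (hg : IsWeightedHomogeneous wz g e) (hl : loc K g ∈ idealOfVars (Fin 2) K ^ n) :
    ∃ P : Polynomial K, par K g = Polynomial.X ^ ((39 * e + 102) / 103) * r₇ K ^ n * P ∧
      (P ≠ 0 → (39 * e + 102) / 103 + 7 * n + P.natDegree ≤ 68 * e / 169) := by
  have h := exists_par_eq (g := g) (A := (39 * e + 102) / 103) (n := n) (m := 68 * e / 169)
    (u := 1) isCoprime_one_right one_ne_zero (fun d hd => ?_) (fun d hd => ?_)
    (r₇_pow_dvd hg hl)
  · simpa using h
  · have := weight_eq hg hd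
    rw [mul_one]
    exact ((pow_dvd_pow _ (by omega)).mul_right _).mul_right _
  · have := weight_eq hg hd
    omega

lemma eq_zero_of_sum_C_mul_X_pow_eq_zero {a : Fin 8 → K}
    (h : ∑ i, Polynomial.C (a i) * Polynomial.X ^ (i : ℕ) = 0) : a = 0 := by
  funext i
  have := congrArg (Polynomial.coeff · (i : ℕ)) h
  simpa [Polynomial.finsetSum_coeff, Polynomial.coeff_C_mul, Polynomial.coeff_X_pow,
    Fin.val_inj] using this

lemma exists_eq_sum_range {P : Polynomial K} {n : ℕ} (h : P.natDegree < n) :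
    ∃ p : ℕ → K, P = ∑ i ∈ Finset.range n, Polynomial.C (p i) * Polynomial.X ^ i := by
  refine ⟨P.coeff, ?_⟩
  conv_lhs => rw [P.as_sum_range' n h]
  simp only [Polynomial.C_mul_X_pow_eq_monomial]

lemma derivative_q₂ : Polynomial.derivative (q₂ K) = -2 * Polynomial.X + 3 := by
  simp [q₂]
  exact one_add_one_eq_two

lemma derivative_q₄ : Polynomial.derivative (q₄ K) =
    -4 * Polynomial.X ^ 3 + 9 * Polynomial.X ^ 2 - 14 * Polynomial.X + 5 := by
  simp [q₄]
  simp only [map_ofNat]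
  ring

lemma derivative_r₇ : Polynomial.derivative (r₇ K) =
    7 * Polynomial.X ^ 6 - 24 * Polynomial.X ^ 5 + 80 * Polynomial.X ^ 4
      - 140 * Polynomial.X ^ 3 + 138 * Polynomial.X ^ 2 - 60 * Polynomial.X + 9 := by
  simp [r₇]
  simp only [map_ofNat]
  ring

/-- The linear system satisfied by the first order data of an extremal element has no solution. -/
lemma extremal_system [CharZero K] {P Q R : Polynomial K} {t : K} (hP : P.natDegree < 6)
    (hQ : Q.natDegree < 5) (hR : R.natDegree < 3)
    (h₁ : 5 * (Polynomial.X * P) + 103 * (q₂ K * Q) + 169 * (Polynomial.X * q₄ K * R)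
      = Polynomial.C (17407 * t) * r₇ K)
    (h₂ : 2 * (Polynomial.X * P)
        + (39 * q₂ K + Polynomial.X * Polynomial.derivative (q₂ K)) * Q
        + Polynomial.X * (64 * q₄ K + Polynomial.X * Polynomial.derivative (q₄ K)) * R
      = Polynomial.C t * (6591 * r₇ K + 59 * (Polynomial.X * Polynomial.derivative (r₇ K))))
    (h₃ : (Polynomial.X * P - 47 * (q₂ K * Q)).natDegree < 6) : t = 0 := by
  obtain ⟨p, rfl⟩ := exists_eq_sum_range hP
  obtain ⟨q, rfl⟩ := exists_eq_sum_range hQ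
  obtain ⟨r, rfl⟩ := exists_eq_sum_range hR
  simp only [Finset.sum_range_succ, Finset.sum_range_zero] at h₁ h₂ h₃
  rw [derivative_q₂, derivative_q₄, derivative_r₇, q₂, q₄, r₇] at h₂
  rw [q₂, q₄, r₇] at h₁
  have E₁ := eq_zero_of_sum_C_mul_X_pow_eq_zero (a := ![
    -103 * q 0 + 17407 * t,
    5 * p 0 + 309 * q 0 - 103 * q 1 - 169 * r 0 - 156663 * t,
    5 * p 1 - 103 * q 0 + 309 * q 1 - 103 * q 2 + 845 * r 0 - 169 * r 1 + 522210 * t,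
    5 * p 2 - 103 * q 1 + 309 * q 2 - 103 * q 3 - 1183 * r 0 + 845 * r 1 - 169 * r 2 - 800722 * t,
    5 * p 3 - 103 * q 2 + 309 * q 3 - 103 * q 4 + 507 * r 0 - 1183 * r 1 + 845 * r 2 + 609245 * t,
    5 * p 4 - 103 * q 3 + 309 * q 4 - 169 * r 0 + 507 * r 1 - 1183 * r 2 - 278512 * t,
    5 * p 5 - 103 * q 4 - 169 * r 1 + 507 * r 2 + 69628 * t,
    -169 * r 2 - 17407 * t]) (by
      simp only [Fin.sum_univ_eight, Matrix.cons_val, map_add, map_sub, map_mul, map_neg, map_ofNat,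
        Fin.isValue, Fin.coe_ofNat_eq_mod]
      simp only [map_mul, map_ofNat] at h₁
      norm_num only
      linear_combination h₁)
  have E₂ := eq_zero_of_sum_C_mul_X_pow_eq_zero (a := ![
    -39 * q 0 + 6591 * t,
    2 * p 0 + 120 * q 0 - 39 * q 1 - 64 * r 0 - 59850 * t,
    2 * p 1 - 41 * q 0 + 120 * q 1 - 39 * q 2 + 325 * r 0 - 64 * r 1 + 201270 * t,
    2 * p 2 - 41 * q 1 + 120 * q 2 - 39 * q 3 - 462 * r 0 + 325 * r 1 - 64 * r 2 - 311328 * t,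
    2 * p 3 - 41 * q 2 + 120 * q 3 - 39 * q 4 + 201 * r 0 - 462 * r 1 + 325 * r 2 + 238945 * t,
    2 * p 4 - 41 * q 3 + 120 * q 4 - 68 * r 0 + 201 * r 1 - 462 * r 2 - 110176 * t,
    2 * p 5 - 41 * q 4 - 68 * r 1 + 201 * r 2 + 27780 * t,
    -68 * r 2 - 7004 * t]) (by
      simp only [Fin.sum_univ_eight, Matrix.cons_val, map_add, map_sub, map_mul, map_neg, map_ofNat,
        Fin.isValue, Fin.coe_ofNat_eq_mod]
      norm_num only
      linear_combination h₂)
  have h₄ : p 5 + 47 * q 4 = 0 := by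
    have := Polynomial.coeff_eq_zero_of_natDegree_lt h₃
    have h : Polynomial.X * (0 + Polynomial.C (p 0) * Polynomial.X ^ 0
          + Polynomial.C (p 1) * Polynomial.X ^ 1 + Polynomial.C (p 2) * Polynomial.X ^ 2
          + Polynomial.C (p 3) * Polynomial.X ^ 3 + Polynomial.C (p 4) * Polynomial.X ^ 4
          + Polynomial.C (p 5) * Polynomial.X ^ 5)
        - 47 * (q₂ K * (0 + Polynomial.C (q 0) * Polynomial.X ^ 0
          + Polynomial.C (q 1) * Polynomial.X ^ 1 + Polynomial.C (q 2) * Polynomial.X ^ 2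
          + Polynomial.C (q 3) * Polynomial.X ^ 3 + Polynomial.C (q 4) * Polynomial.X ^ 4))
        = Polynomial.C (p 5 + 47 * q 4) * Polynomial.X ^ 6
          + Polynomial.C (p 4 + 47 * q 3 - 141 * q 4) * Polynomial.X ^ 5
          + Polynomial.C (p 3 + 47 * q 2 - 141 * q 3 + 47 * q 4) * Polynomial.X ^ 4
          + Polynomial.C (p 2 + 47 * q 1 - 141 * q 2 + 47 * q 3) * Polynomial.X ^ 3
          + Polynomial.C (p 1 + 47 * q 0 - 141 * q 1 + 47 * q 2) * Polynomial.X ^ 2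
          + Polynomial.C (p 0 - 141 * q 0 + 47 * q 1) * Polynomial.X ^ 1
          + Polynomial.C (47 * q 0) * Polynomial.X ^ 0 := by
      simp only [q₂, map_add, map_sub, map_mul, map_ofNat]
      ring
    rw [h] at this
    simpa only [Polynomial.coeff_add, Polynomial.coeff_C_mul_X_pow, Nat.reduceEqDiff, if_true,
      if_false, add_zero] using this
  have f (i : Fin 8) := congrFun E₁ i
  have g (i : Fin 8) := congrFun E₂ i
  have f0 := f 0
  have f1 := f 1
  have f2 := f 2
  have f3 := f 3
  have f4 := f 4
  have f5 := f 5
  have f6 := f 6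
  have f7 := f 7
  have g1 := g 1
  have g2 := g 2
  have g3 := g 3
  have g4 := g 4
  have g5 := g 5
  have g6 := g 6
  simp only [Matrix.cons_val, Pi.zero_apply] at f0 f1 f2 f3 f4 f5 f6 f7 g1 g2 g3 g4 g5 g6
  have : (36390724 * 1521 : K) * t = 0 := by
    linear_combination -18704751 * f0 - 221869622 * f1 - 140474490 * f2 - 87974978 * f3
      - 38330214 * f4 + 277780906 * f5 + 508940922 * f6 - 13516690 * f7 + 554674055 * g1
      + 351186225 * g2 + 219937445 * g3 + 95825535 * g4 - 694452265 * g5 - 1254156943 * g6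
      - 36390724 * h₄
  exact (mul_eq_zero.mp this).resolve_left (by norm_num)

lemma mem_support_of_mem_support_euler {i : Fin 3} {g : MvPolynomial (Fin 3) K} {d : Fin 3 →₀ ℕ}
    (hd : d ∈ (euler i g).support) : d ∈ g.support ∧ d i ≠ 0 := by
  rw [mem_support_iff, coeff_euler] at hd
  refine ⟨mem_support_iff.mpr (right_ne_zero_of_mul hd), fun h => ?_⟩
  simp [h] at hd

lemma X_mul_derivative_X_pow_mul (n : ℕ) (u : Polynomial K) :
    Polynomial.X * Polynomial.derivative (Polynomial.X ^ n * u) =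
      Polynomial.X ^ n * ((n : Polynomial K) * u + Polynomial.X * Polynomial.derivative u) := by
  rw [Polynomial.derivative_mul, Polynomial.derivative_X_pow]
  rcases n with _ | n
  · simp
  · rw [Nat.add_sub_cancel, map_natCast]
    ring

/-- There is no element of degree `17407 k` and multiplicity `59 k` which does not vanish on the
negative curve. -/
lemma eq_zero_of_extremal [CharZero K] {k : ℕ} (hk : k ≠ 0) {g : MvPolynomial (Fin 3) K}
    (hg : IsWeightedHomogeneous wz g (17407 * k : ℕ))
    (hl : loc K g ∈ idealOfVars (Fin 2) K ^ (59 * k)) {c : K}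
    (hc : par K g = Polynomial.X ^ (6591 * k) * (Polynomial.C c * r₇ K ^ (59 * k))) : c = 0 := by
  obtain ⟨n, hn⟩ : ∃ n, 59 * k = n + 1 := ⟨59 * k - 1, by omega⟩
  have hsup (i : Fin 3) : ∀ d ∈ (euler i g).support,
      5 * d 0 + 103 * d 1 + 169 * d 2 = 17407 * k ∧ d i ≠ 0 := fun d hd =>
    ⟨weight_eq hg (mem_support_of_mem_support_euler hd).1,
      (mem_support_of_mem_support_euler hd).2⟩
  have hr (i : Fin 3) : r₇ K ^ n ∣ par K (euler i g) := by
    obtain ⟨h1, h2⟩ := loc_euler_mem hg hl i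
    rw [hn, Nat.add_sub_cancel] at h2
    exact r₇_pow_dvd h1 h2
  set A := 6591 * k with hA
  obtain ⟨P, hP, hPd⟩ := exists_par_eq (g := euler 0 g) (A := A + 1) (n := n)
    (m := 7004 * k - 1) (u := 1) isCoprime_one_right one_ne_zero (fun d hd => by
      have := hsup 0 d hd
      rw [mul_one]
      exact ((pow_dvd_pow _ (by omega)).mul_right _).mul_right _) (fun d hd => by
      have := hsup 0 d hd
      omega) (hr 0)
  obtain ⟨Q, hQ, hQd⟩ := exists_par_eq (g := euler 1 g) (A := A) (n := n)
    (m := 7004 * k - 1) (u := q₂ K) isCoprime_q₂_r₇.symm q₂_ne_zero (fun d hd => by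
      have := hsup 1 d hd
      exact (mul_dvd_mul (pow_dvd_pow _ (by omega)) (dvd_pow_self _ this.2)).mul_right _)
      (fun d hd => by
      have := hsup 1 d hd
      omega) (hr 1)
  have hq₄r₇ : IsCoprime (r₇ K) (q₄ K) := by
    rw [r₇_eq, show q₂ K ^ 3 - Polynomial.X ^ 3 * q₄ K
      = q₂ K ^ 3 + q₄ K * (-Polynomial.X ^ 3) by ring]
    exact (isCoprime_q₂_q₄.pow_left).add_mul_left_left _
  obtain ⟨R, hR, hRd⟩ := exists_par_eq (g := euler 2 g) (A := A + 1) (n := n)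
    (m := 7004 * k) (u := q₄ K) hq₄r₇ q₄_ne_zero (fun d hd => by
      have := hsup 2 d hd
      rw [mul_right_comm]
      exact (mul_dvd_mul (pow_dvd_pow _ (by omega)) (dvd_pow_self _ this.2)).mul_right _)
      (fun d hd => by
      have := hsup 2 d hd
      omega) (hr 2)
  rw [natDegree_q₂] at hQd
  rw [natDegree_q₄] at hRd
  rw [Polynomial.natDegree_one] at hPd
  set ρ : Polynomial K := Polynomial.X ^ A * r₇ K ^ n with hρ
  have hρ0 : ρ ≠ 0 := mul_ne_zero (by simp) (pow_ne_zero _ r₇_ne_zero)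
  have hρd : ρ.natDegree = A + 7 * n := by
    rw [hρ, Polynomial.natDegree_mul (by simp) (pow_ne_zero _ r₇_ne_zero),
      Polynomial.natDegree_X_pow, Polynomial.natDegree_pow, natDegree_r₇, mul_comm n]
  have hkK : (59 * k : K) = n + 1 := by exact_mod_cast congrArg (Nat.cast (R := K)) hn
  have key : (k : K) * c = 0 := by
    refine extremal_system (P := P) (Q := Q) (R := R) ?_ ?_ ?_ ?_ ?_ ?_
    · by_cases h : P = 0
      · simp [h]
      · have := hPd h
        omega
    · by_cases h : Q = 0
      · simp [h]
      · have := hQd h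
        omega
    · by_cases h : R = 0
      · simp [h]
      · have := hRd h
        omega
    · have h1 := congrArg (par K) (euler_relation hg)
      simp only [map_add, map_mul, map_ofNat, algHom_C, Polynomial.algebraMap_eq, hP, hQ, hR,
        hc, hn, Nat.cast_mul, Nat.cast_ofNat] at h1
      refine mul_left_cancel₀ hρ0 ?_
      rw [hρ]
      simp only [map_mul, map_ofNat]
      linear_combination h1
    · have h1 := congrArg (Polynomial.X * ·) (derivative_par g)
      have e0 : Polynomial.X ^ 2 * par K (pderiv 0 g) = ρ * (Polynomial.X * P) := by
        rw [← par_X_zero, ← map_mul]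
        exact hP.trans (by rw [hρ]; ring)
      have e1 : Polynomial.X ^ 39 * par K (pderiv 1 g) = ρ * Q := by
        refine mul_left_cancel₀ q₂_ne_zero ?_
        rw [← mul_assoc, mul_comm (q₂ K), ← par_X_one, ← map_mul]
        exact hQ.trans (by rw [hρ]; ring)
      have e2 : Polynomial.X ^ 64 * par K (pderiv 2 g) = ρ * (Polynomial.X * R) := by
        refine mul_left_cancel₀ q₄_ne_zero ?_
        rw [← mul_assoc, mul_comm (q₄ K), ← par_X_two, ← map_mul]
        exact hR.trans (by rw [hρ]; ring)
      have h2 := X_mul_derivative_X_pow_mul A (Polynomial.C c * r₇ K ^ (59 * k))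
      have h3 := X_mul_derivative_X_pow_mul 39 (q₂ K)
      have h4 := X_mul_derivative_X_pow_mul 64 (q₄ K)
      have h5 := X_mul_derivative_X_pow_mul 2 (1 : Polynomial K)
      rw [← hc, hn, Polynomial.derivative_mul, Polynomial.derivative_C,
        Polynomial.derivative_pow_succ] at h2
      simp only [Fin.sum_univ_three, par_X_zero, par_X_one, par_X_two] at h1
      rw [mul_one, Polynomial.derivative_one] at h5
      rw [h2] at h1
      refine mul_left_cancel₀ hρ0 ?_
      have hk1 : (A : Polynomial K) = 6591 * (k : Polynomial K) := by rw [hA]; push_cast; rfl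
      have hk2 : (59 * k : Polynomial K) = Polynomial.C ((n : K) + 1) := by
        rw [← hkK, map_mul, map_natCast, map_ofNat]
      rw [hk1, ← hk2] at h1
      rw [map_mul, map_natCast]
      rw [hρ] at e0 e1 e2 ⊢
      push_cast at h3 h4 h5
      linear_combination -h1 - 2 * e0
        - (39 * q₂ K + Polynomial.X * Polynomial.derivative (q₂ K)) * e1
        - (64 * q₄ K + Polynomial.X * Polynomial.derivative (q₄ K)) * e2
        - par K (pderiv 0 g) * h5 - par K (pderiv 1 g) * h3 - par K (pderiv 2 g) * h4
    · by_cases hW : Polynomial.X * P - 47 * (q₂ K * Q) = 0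
      · simp [hW]
      have h1 : (par K (euler 0 g - C 47 * euler 1 g)).natDegree ≤ 7004 * k - 2 := by
        refine natDegree_par_le fun d hd => ?_
        rw [mem_support_iff, coeff_sub, coeff_C_mul, coeff_euler, coeff_euler] at hd
        have h2 : ((d 0 : K) - 47 * d 1) * coeff d g ≠ 0 := by
          convert hd using 1
          ring
        have h3 := weight_eq hg (mem_support_iff.mpr (right_ne_zero_of_mul h2))
        have h4 : d 0 ≠ 47 * d 1 := fun h => left_ne_zero_of_mul h2 (by rw [h]; push_cast; ring)
        omega
      have h2 : par K (euler 0 g - C 47 * euler 1 g) =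
          ρ * (Polynomial.X * P - 47 * (q₂ K * Q)) := by
        rw [map_sub, map_mul, hP, hQ, hρ, algHom_C, map_ofNat]
        ring
      rw [h2, Polynomial.natDegree_mul hρ0 hW, hρd] at h1
      omega
  exact (mul_eq_zero.mp key).resolve_left (by exact_mod_cast hk)

/-- An element not vanishing on the negative curve lies strictly inside the cone. -/
lemma slope_lt [CharZero K] {e n : ℕ} (he : e ≠ 0) {g : MvPolynomial (Fin 3) K}
    (hg : IsWeightedHomogeneous wz g e) (hl : loc K g ∈ idealOfVars (Fin 2) K ^ n)
    (h0 : par K g ≠ 0) : 17407 * n < 59 * e := by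
  obtain ⟨P, hP, hPd⟩ := exists_par_eq_of_isWeightedHomogeneous hg hl
  have hP0 : P ≠ 0 := fun h => h0 (by rw [hP, h, mul_zero])
  have h1 := hPd hP0
  by_contra hlt
  have h2 : 17407 * n = 59 * e := by omega
  obtain ⟨k, rfl⟩ : 17407 ∣ e :=
    Nat.Coprime.dvd_of_dvd_mul_left (by norm_num : Nat.Coprime 17407 59) ⟨n, h2.symm⟩
  obtain rfl : n = 59 * k := by omega
  have h3 : P.natDegree = 0 := by omega
  rw [Polynomial.eq_C_of_natDegree_eq_zero h3] at hP hP0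
  refine hP0 ?_
  rw [eq_zero_of_extremal (c := P.coeff 0) (by omega : k ≠ 0) hg hl ?_, map_zero]
  rw [hP, show (39 * (17407 * k) + 102) / 103 = 6591 * k by omega]
  ring

lemma coeff_mem_symbPow {A : Type*} [CommRing A] (Q : Ideal A) [Q.IsPrime] {P : Polynomial A}
    (hP : P ∈ symbolicRees Q) (n : ℕ) : P.coeff n ∈ symbPow Q n := by
  induction hP using Algebra.adjoin_induction generalizing n with
  | mem P hP =>
    obtain ⟨m, p, hp, rfl⟩ := Set.mem_iUnion.mp hP
    dsimp only
    rw [Polynomial.coeff_C_mul_X_pow]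
    split_ifs with h
    · exact h ▸ hp
    · exact zero_mem _
  | algebraMap r =>
    rw [Polynomial.algebraMap_apply, Algebra.algebraMap_self_apply, Polynomial.coeff_C]
    split_ifs with h
    · exact h ▸ mem_symbPow_zero Q r
    · exact zero_mem _
  | add P P' _ _ h h' => exact Polynomial.coeff_add P P' n ▸ add_mem (h n) (h' n)
  | mul P P' _ _ h h' =>
    rw [Polynomial.coeff_mul]
    refine sum_mem fun i hi => ?_
    rw [← Finset.HasAntidiagonal.mem_antidiagonal.mp hi]
    exact symbPow_mul_mem Q (h _) (h' _)

lemma monomial_mem_symbolicRees {A : Type*} [CommRing A] (Q : Ideal A) [Q.IsPrime] {n : ℕ} {p : A}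
    (hp : p ∈ symbPow Q n) : Polynomial.C p * Polynomial.X ^ n ∈ symbolicRees Q :=
  Algebra.subset_adjoin (Set.mem_iUnion.mpr ⟨n, p, hp, rfl⟩)

/-- The map `par`, keeping track of the degree with an extra variable. -/
def gpar (K : Type*) [Field K] : MvPolynomial (Fin 3) K →ₐ[K] Polynomial (Polynomial K) :=
  aeval ![Polynomial.C (par K (X 0)) * Polynomial.X ^ 5,
    Polynomial.C (par K (X 1)) * Polynomial.X ^ 103,
    Polynomial.C (par K (X 2)) * Polynomial.X ^ 169]

lemma gpar_monomial (d : Fin 3 →₀ ℕ) (c : K) :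
    gpar K (monomial d c) = Polynomial.C (par K (monomial d c)) * Polynomial.X ^ deg d := by
  rw [monomial_eq_C_mul]
  simp only [gpar, map_mul, map_pow, aeval_X, algHom_C, deg, Polynomial.algebraMap_apply,
    Matrix.cons_val_zero, Matrix.cons_val_one, Matrix.cons_val]
  ring

lemma coeff_gpar (e : ℕ) (g : MvPolynomial (Fin 3) K) :
    (gpar K g).coeff e = par K (weightedHomogeneousComponent wz (e : ℤ) g) := by
  induction g using MvPolynomial.induction_on' with
  | add p q hp hq => simp [hp, hq]
  | monomial u c =>
    rw [gpar_monomial, Polynomial.coeff_C_mul_X_pow,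
      weightedHomogeneousComponent_of_mem (n := (deg u : ℤ)) (m := (e : ℤ))
        (isWeightedHomogeneous_monomial _ _ _ (weight_wz_eq_deg u))]
    simp only [Nat.cast_inj]
    split_ifs <;> simp

lemma weightedHomogeneousComponent_wz_zero (g : MvPolynomial (Fin 3) K) :
    weightedHomogeneousComponent wz 0 g = C (coeff 0 g) := by
  ext d
  rw [coeff_weightedHomogeneousComponent, coeff_C]
  have : Finsupp.weight wz d = 0 ↔ 0 = d := by
    rw [weight_wz]
    constructor
    · intro h
      ext i
      fin_cases i <;> simp <;> omega
    · rintro rfl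
      simp
  simp only [this]
  split_ifs with h
  · rw [h]
  · rfl

/-- The bihomogeneous components of an element of the Rees algebra, composed with `par`. -/
def bipar (K : Type*) [Field K] :
    Polynomial (MvPolynomial (Fin 3) K) →+* Polynomial (Polynomial (Polynomial K)) :=
  Polynomial.mapRingHom (gpar K).toRingHom

lemma coeff_bipar (P : Polynomial (MvPolynomial (Fin 3) K)) (n e : ℕ) :
    ((bipar K P).coeff n).coeff e =
      par K (weightedHomogeneousComponent wz (e : ℤ) (P.coeff n)) := by
  rw [bipar, Polynomial.coe_mapRingHom, Polynomial.coeff_map, ← coeff_gpar]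
  rfl

lemma exists_of_coeff_mul_ne_zero {R : Type*} [CommRing R] {P Q : Polynomial (Polynomial R)}
    {n e : ℕ} (h : ((P * Q).coeff n).coeff e ≠ 0) :
    ∃ n₁ n₂ e₁ e₂ : ℕ, n₁ + n₂ = n ∧ e₁ + e₂ = e ∧ (P.coeff n₁).coeff e₁ ≠ 0 ∧
      (Q.coeff n₂).coeff e₂ ≠ 0 := by
  rw [Polynomial.coeff_mul, Polynomial.finsetSum_coeff] at h
  obtain ⟨i, hi, h⟩ := Finset.exists_ne_zero_of_sum_ne_zero h
  rw [Polynomial.coeff_mul] at h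
  obtain ⟨j, hj, h⟩ := Finset.exists_ne_zero_of_sum_ne_zero h
  exact ⟨i.1, i.2, j.1, j.2, Finset.HasAntidiagonal.mem_antidiagonal.mp hi,
    Finset.HasAntidiagonal.mem_antidiagonal.mp hj, left_ne_zero_of_mul h, right_ne_zero_of_mul h⟩

lemma exists_coeff_coeff_bound {R : Type*} [CommRing R] (P : Polynomial (Polynomial R)) :
    ∃ B : ℕ, ∀ n e, (P.coeff n).coeff e ≠ 0 → e ≤ B := by
  refine ⟨P.support.sup fun n => (P.coeff n).natDegree, fun n e h => ?_⟩
  refine (Polynomial.le_natDegree_of_ne_zero h).trans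
    (Finset.le_sup (f := fun n => (P.coeff n).natDegree) (Polynomial.mem_support_iff.mpr ?_))
  rintro h0
  simp [h0] at h

lemma slope_lt_of_mem_symbolicRees [CharZero K] {P : Polynomial (MvPolynomial (Fin 3) K)}
    (hP : P ∈ symbolicRees (pIdeal K 5 103 169)) {n e : ℕ}
    (h : ((bipar K P).coeff n).coeff e ≠ 0) (hne : n ≠ 0 ∨ e ≠ 0) : 17407 * n < 59 * e := by
  have hl := loc_component_mem (coeff_mem_symbPow _ hP n) e
  rw [coeff_bipar] at h
  rcases eq_or_ne e 0 with rfl | he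
  · exfalso
    rw [Nat.cast_zero, weightedHomogeneousComponent_wz_zero] at h hl
    rw [algHom_C, algebraMap_eq, mem_pow_idealOfVars_iff'] at hl
    have := hl 0 (by simpa using Nat.pos_of_ne_zero (hne.resolve_right (by simp)))
    rw [coeff_C, if_pos rfl] at this
    simp [this] at h
  · exact slope_lt he (weightedHomogeneousComponent_isWeightedHomogeneous _ _) hl h

theorem exists_slope_le_of_isNoetherianRing [CharZero K]
    (hN : IsNoetherianRing (symbolicRees (pIdeal K 5 103 169))) :
    ∃ M : ℕ, 0 < M ∧ ∀ (e n : ℕ) (g : MvPolynomial (Fin 3) K),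
      IsWeightedHomogeneous wz g (e : ℤ) → loc K g ∈ idealOfVars (Fin 2) K ^ n → par K g ≠ 0 →
      e + 17407 * M * n ≤ 59 * M * e := by
  set R := symbolicRees (pIdeal K 5 103 169) with hR
  let f : R →+* Polynomial K := (Polynomial.constantCoeff.comp Polynomial.constantCoeff).comp
    ((bipar K).comp R.val.toRingHom)
  have hf : ∀ P : R, f P = ((bipar K P).coeff 0).coeff 0 := fun P => rfl
  obtain ⟨s, hs⟩ := (isNoetherianRing_iff_ideal_fg _).mp hN (RingHom.ker f)
  choose B hB using fun P : R => exists_coeff_coeff_bound (bipar K (P : Polynomial _))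
  set M := s.sup B + 1 with hM
  have hgen : ∀ P ∈ s, ∀ n e, ((bipar K (P : Polynomial _)).coeff n).coeff e ≠ 0 →
      e + 17407 * M * n ≤ 59 * M * e := by
    intro P hPs n e h
    have h0 : f P = 0 := RingHom.mem_ker.mp (hs ▸ Ideal.subset_span hPs)
    have hne : n ≠ 0 ∨ e ≠ 0 := by
      by_contra! hne
      rw [hne.1, hne.2] at h
      exact h h0
    have h1 := slope_lt_of_mem_symbolicRees P.2 h hne
    have h2 : e ≤ M := (hB P n e h).trans ((Finset.le_sup hPs).trans (Nat.le_succ _))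
    nlinarith
  have key : ∀ N : ℕ, ∀ P : R, ∀ n e, n + e ≤ N →
      ((bipar K (P : Polynomial _)).coeff n).coeff e ≠ 0 →
      e + 17407 * M * n ≤ 59 * M * e := by
    intro N
    induction N with
    | zero =>
      intro P n e hne _
      obtain ⟨rfl, rfl⟩ : n = 0 ∧ e = 0 := by omega
      simp
    | succ N ih =>
      have hspan : ∀ P : R, P ∈ Ideal.span (s : Set R) → f P = 0 ∧ ∀ n e, n + e ≤ N + 1 →
          ((bipar K (P : Polynomial _)).coeff n).coeff e ≠ 0 →
          e + 17407 * M * n ≤ 59 * M * e := by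
        intro P hP
        refine ⟨RingHom.mem_ker.mp (hs ▸ hP), ?_⟩
        induction hP using Submodule.span_induction with
        | mem P hP => exact fun n e _ => hgen P hP n e
        | zero => simp
        | add P Q _ _ h h' =>
          intro n e hne hPQ
          by_cases hP0 : ((bipar K (P : Polynomial _)).coeff n).coeff e = 0
          · refine h' n e hne fun hQ0 => hPQ ?_
            simp [hP0, hQ0]
          · exact h n e hne hP0
        | smul H P hP h =>
          intro n e hne hHP
          rw [smul_eq_mul, MulMemClass.coe_mul, map_mul] at hHP
          obtain ⟨n₁, n₂, e₁, e₂, rfl, rfl, h₁, h₂⟩ := exists_of_coeff_mul_ne_zero hHP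
          have hP0 : f P = 0 := RingHom.mem_ker.mp (hs ▸ hP)
          have : n₂ + e₂ ≠ 0 := by
            intro h0
            obtain ⟨rfl, rfl⟩ : n₂ = 0 ∧ e₂ = 0 := by omega
            exact h₂ hP0
          have := ih H n₁ e₁ (by omega) h₁
          have := h n₂ e₂ (by omega) h₂
          linarith
      intro P n e hne h
      by_cases h00 : n = 0 ∧ e = 0
      · simp [h00.1, h00.2]
      set c := coeff 0 ((P : Polynomial (MvPolynomial (Fin 3) K)).coeff 0) with hc
      set P' : R := P - algebraMap (MvPolynomial (Fin 3) K) R (C c) with hP'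
      have hb : ∀ m i, ((bipar K (P' : Polynomial _)).coeff m).coeff i =
          ((bipar K (P : Polynomial _)).coeff m).coeff i -
            if i = 0 ∧ m = 0 then Polynomial.C c else 0 := by
        intro m i
        have : ((algebraMap (MvPolynomial (Fin 3) K) R (C c) : R) : Polynomial (MvPolynomial (Fin 3) K)) =
          Polynomial.C (C c) := rfl
        rw [hP', AddSubgroupClass.coe_sub, map_sub, this, bipar, Polynomial.coeff_sub,
          Polynomial.coeff_sub, Polynomial.coe_mapRingHom, Polynomial.map_C, Polynomial.coeff_C]
        congr 1
        by_cases hm : m = 0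
        · simp [hm, Polynomial.coeff_C]
        · simp [hm]
      refine (hspan P' ?_).2 n e hne ?_
      · rw [← SetLike.mem_coe, hs, SetLike.mem_coe, RingHom.mem_ker, hf, hb, coeff_bipar, Nat.cast_zero,
          weightedHomogeneousComponent_wz_zero]
        simp [hc]
      · rw [hb, if_neg (by tauto), sub_zero]
        exact h
  refine ⟨M, Nat.succ_pos _, fun e n g hg hl h0 => ?_⟩
  refine key (n + e) ⟨_, monomial_mem_symbolicRees _ (mem_symbPow_of_loc_mem hg hl)⟩ n e le_rfl ?_
  rw [coeff_bipar, Polynomial.coeff_C_mul_X_pow, if_pos rfl,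
    weightedHomogeneousComponent_of_mem hg, if_pos rfl]
  exact h0

/-- The exponents of the monomials of degree `e`. -/
def exponents (e : ℕ) : Set (Fin 3 →₀ ℕ) := {d | deg d = e}

lemma finite_exponents (e : ℕ) : (exponents e).Finite := by
  refine (Set.finite_Iic (Finsupp.equivFunOnFinite.symm fun _ => e : Fin 3 →₀ ℕ)).subset ?_
  intro d hd i
  have hd : 5 * d 0 + 103 * d 1 + 169 * d 2 = e := hd
  simp only [Finsupp.equivFunOnFinite_symm_apply_apply]
  fin_cases i <;> simp <;> omega

/-- An exponent of degree `e` with prescribed first entry, see `deg_exponentAt`. -/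
def exponentAt (e i q : ℕ) : Fin 3 →₀ ℕ :=
  let j := (64 * (e - 5 * i)) % 169 + 169 * q
  Finsupp.equivFunOnFinite.symm ![i, j, (e - 5 * i - 103 * j) / 169]

lemma deg_exponentAt {e i q : ℕ} (hi : i < 413) (hq : q < e / 17407 - 1) :
    deg (exponentAt e i q) = e := by
  simp only [deg, exponentAt, Finsupp.equivFunOnFinite_symm_apply_apply, Matrix.cons_val_zero,
    Matrix.cons_val_one, Matrix.cons_val]
  omega

lemma exponentAt_zero (e i q : ℕ) : exponentAt e i q 0 = i := rfl

lemma exponentAt_injective (e : ℕ) :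
    Function.Injective fun p : ℕ × ℕ => exponentAt e p.1 p.2 := by
  rintro ⟨i, q⟩ ⟨i', q'⟩ h
  obtain rfl : i = i' := DFunLike.congr_fun h 0
  have h1 : (64 * (e - 5 * i)) % 169 + 169 * q = (64 * (e - 5 * i)) % 169 + 169 * q' :=
    DFunLike.congr_fun h 1
  rw [Nat.mul_left_cancel (by norm_num) (Nat.add_left_cancel h1)]

lemma ncard_exponents_add (e : ℕ) {m : ℕ} (hm : m ≤ 413) :
    (exponents e).ncard + m * ((e + 5 * m) / 17407 - 1) ≤ (exponents (e + 5 * m)).ncard := by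
  set Q := (e + 5 * m) / 17407 - 1 with hQ
  set A := (fun d : Fin 3 →₀ ℕ => d + Finsupp.single 0 m) '' exponents e with hA
  set B := (fun p : ℕ × ℕ => exponentAt (e + 5 * m) p.1 p.2) ''
    (Finset.range m ×ˢ Finset.range Q : Finset (ℕ × ℕ)) with hB
  have cA : A.ncard = (exponents e).ncard :=
    Set.ncard_image_of_injective _ (add_left_injective _)
  have cB : B.ncard = m * Q := by
    rw [hB, Set.ncard_image_of_injective _ (exponentAt_injective _), Set.ncard_coe_finset,
      Finset.card_product, Finset.card_range, Finset.card_range]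
  have hAB : Disjoint A B := by
    rw [Set.disjoint_left]
    rintro _ ⟨d, -, rfl⟩ ⟨p, hp, h⟩
    have h0 := DFunLike.congr_fun h 0
    simp only [exponentAt_zero, Finsupp.add_apply, Finsupp.single_eq_same] at h0
    simp only [Finset.coe_product, Set.mem_prod, Finset.mem_coe, Finset.mem_range] at hp
    omega
  have hsub : A ∪ B ⊆ exponents (e + 5 * m) := by
    rintro _ (⟨d, hd, rfl⟩ | ⟨p, hp, rfl⟩)
    · have hd : deg d = e := hd
      change deg _ = _
      simp [deg] at hd ⊢
      omega
    · simp only [Finset.coe_product, Set.mem_prod, Finset.mem_coe, Finset.mem_range] at hp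
      exact deg_exponentAt (hp.1.trans_le hm) hp.2
  have fin := (finite_exponents (e + 5 * m)).subset hsub
  rw [← cA, ← cB, ← Set.ncard_union_eq hAB (fin.subset Set.subset_union_left)
    (fin.subset Set.subset_union_right)]
  exact Set.ncard_le_ncard hsub (finite_exponents _)

/-- The weighted homogeneous polynomials of degree `e`. -/
abbrev homog (K : Type*) [Field K] (e : ℕ) : Submodule K (MvPolynomial (Fin 3) K) :=
  weightedHomogeneousSubmodule K wz (e : ℤ)

lemma homog_eq (e : ℕ) : homog K e = restrictSupport K (exponents e) := by
  rw [homog, weightedHomogeneousSubmodule_eq_finsupp_supported, restrictSupport]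
  congr 1
  ext d
  simp only [weight_wz_eq_deg, Set.mem_ofPred_eq, Nat.cast_inj, exponents]

instance (e : ℕ) : Module.Finite K (homog K e) := by
  have := (finite_exponents e).to_subtype
  rw [homog_eq]
  exact Module.Finite.of_basis (basisRestrictSupport K (exponents e))

lemma finrank_homog (e : ℕ) : Module.finrank K (homog K e) = (exponents e).ncard := by
  have := (finite_exponents e).fintype
  rw [homog_eq, Module.finrank_eq_card_basis (basisRestrictSupport K (exponents e)),
    Set.ncard_eq_toFinset_card', Set.toFinset_card]

/-- The weighted homogeneous polynomials of degree `e` vanishing to order `n` at `(1,1,1)`. -/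
def vanishing (K : Type*) [Field K] (e n : ℕ) : Submodule K (MvPolynomial (Fin 3) K) :=
  homog K e ⊓ ((idealOfVars (Fin 2) K ^ n).restrictScalars K).comap (loc K).toLinearMap

lemma mem_vanishing {e n : ℕ} {g : MvPolynomial (Fin 3) K} :
    g ∈ vanishing K e n ↔
      IsWeightedHomogeneous wz g (e : ℤ) ∧ loc K g ∈ idealOfVars (Fin 2) K ^ n :=
  Iff.rfl

instance (e n : ℕ) : Module.Finite K (vanishing K e n) :=
  Submodule.finiteDimensional_of_le (inf_le_left : _ ≤ homog K e)

lemma finrank_homog_le (e n : ℕ) : 2 * Module.finrank K (homog K e) ≤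
    2 * Module.finrank K (vanishing K e n) + n * (n + 1) := by
  let φ : MvPolynomial (Fin 3) K →ₗ[K] ((s : Fin n) × Fin (s + 1) → K) :=
    LinearMap.pi fun p => (lcoeff K (Finsupp.equivFunOnFinite.symm
      ![(p.2 : ℕ), p.1 - p.2] : Fin 2 →₀ ℕ)).comp (loc K).toLinearMap
  have h := LinearMap.finrank_range_add_finrank_ker (φ.domRestrict (homog K e))
  have h1 : Module.finrank K (LinearMap.range (φ.domRestrict (homog K e))) ≤
      Fintype.card ((s : Fin n) × Fin (s + 1)) :=
    (Submodule.finrank_le _).trans (Module.finrank_pi K).le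
  have h2 : 2 * Fintype.card ((s : Fin n) × Fin (s + 1)) = n * (n + 1) := by
    rw [Fintype.card_sigma]
    simp only [Fintype.card_fin]
    rw [Fin.sum_univ_eq_sum_range (fun i => i + 1) n]
    clear * -
    induction n with
    | zero => simp
    | succ n ih => rw [Finset.sum_range_succ, mul_add, ih]; ring
  have h3 : Module.finrank K (LinearMap.ker (φ.domRestrict (homog K e))) ≤
      Module.finrank K (vanishing K e n) := by
    rw [← Submodule.finrank_map_subtype_eq]
    refine Submodule.finrank_mono ?_
    rintro _ ⟨g, hg, rfl⟩
    refine mem_vanishing.mpr ⟨g.2, (mem_pow_idealOfVars_iff' _ _).mpr fun d hd => ?_⟩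
    have hd' : d 0 + d 1 < n := by simpa [Finsupp.degree_eq_sum] using hd
    have := congrFun (LinearMap.mem_ker.mp hg) ⟨⟨d 0 + d 1, hd'⟩, ⟨d 0, by simp⟩⟩
    simp [φ] at this
    rw [Submodule.subtype_apply]
    convert this
    ext i
    fin_cases i <;> simp
  omega

lemma mem_map_curve [CharZero K] {e n : ℕ} {g : MvPolynomial (Fin 3) K}
    (hg : g ∈ vanishing K (e + 2065) (n + 7)) (h0 : par K g = 0) :
    g ∈ (vanishing K e n).map (LinearMap.mulLeft K (curve K)) := by
  obtain ⟨hg, hl⟩ := mem_vanishing.mp hg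
  rw [Nat.cast_add, add_comm, Nat.cast_ofNat] at hg
  obtain ⟨h, hh, rfl⟩ := exists_eq_curve_mul hg h0
  refine ⟨h, mem_vanishing.mpr ⟨hh, ?_⟩, rfl⟩
  rw [map_mul] at hl
  exact mem_pow_idealOfVars_of_mul loc_curve_notMem hl

lemma finrank_vanishing_add_le_of_par_eq_zero [CharZero K] {e n : ℕ}
    (h : ∀ g ∈ vanishing K (e + 2065) (n + 7), par K g = 0) :
    Module.finrank K (vanishing K (e + 2065) (n + 7)) ≤ Module.finrank K (vanishing K e n) :=
  (Submodule.finrank_mono fun g hg => mem_map_curve hg (h g hg)).trans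
    (Submodule.finrank_map_le _ _)

lemma degree_bound {e n : ℕ} (hL : 17407 * n ≤ 59 * e) :
    17407 * (68 * e / 169 + 1 - (39 * e + 102) / 103 - 7 * n) + 17407 * 7 * n ≤
      413 * e + 17407 := by
  omega

lemma finrank_vanishing_add_le [CharZero K] {e n : ℕ} (hL : 17407 * (n + 7) ≤ 59 * (e + 2065)) :
    17407 * Module.finrank K (vanishing K (e + 2065) (n + 7)) + 17407 * 7 * (n + 7) ≤
      17407 * Module.finrank K (vanishing K e n) + 413 * (e + 2065) + 17407 := by
  set V := vanishing K (e + 2065) (n + 7) with hV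
  set a := (39 * (e + 2065) + 102) / 103 with ha
  set δ := 68 * (e + 2065) / 169 + 1 - a - 7 * (n + 7) with hδ
  have hδ' : 17407 * δ + 17407 * 7 * (n + 7) ≤ 413 * (e + 2065) + 17407 :=
    degree_bound hL
  let φ := (par K).toLinearMap.domRestrict V
  have h := LinearMap.finrank_range_add_finrank_ker φ
  have h1 : Module.finrank K (LinearMap.ker φ) ≤ Module.finrank K (vanishing K e n) := by
    rw [← Submodule.finrank_map_subtype_eq]
    refine (Submodule.finrank_mono ?_).trans
      (Submodule.finrank_map_le (LinearMap.mulLeft K (curve K)) _)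
    rintro _ ⟨g, hg, rfl⟩
    exact mem_map_curve g.2 (LinearMap.mem_ker.mp hg)
  have h2 : Module.finrank K (LinearMap.range φ) ≤ δ := by
    have hd : Module.finrank K (Polynomial.degreeLT K δ) = δ := by
      rw [(Polynomial.degreeLTEquiv K δ).finrank_eq, Module.finrank_fin_fun]
    have : Module.Finite K (Polynomial.degreeLT K δ) :=
      Module.Finite.equiv (Polynomial.degreeLTEquiv K δ).symm
    refine ((Submodule.finrank_mono ?_).trans (Submodule.finrank_map_le
      (LinearMap.mulLeft K (Polynomial.X ^ a * r₇ K ^ (n + 7))) (Polynomial.degreeLT K δ))).trans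
      hd.le
    rintro _ ⟨⟨g, hg⟩, rfl⟩
    obtain ⟨hg, hl⟩ := mem_vanishing.mp hg
    obtain ⟨P, hP, hPd⟩ := exists_par_eq_of_isWeightedHomogeneous hg hl
    refine ⟨P, ?_, hP.symm⟩
    by_cases hP0 : P = 0
    · simp [hP0]
    · rw [SetLike.mem_coe, Polynomial.mem_degreeLT, ← Polynomial.natDegree_lt_iff_degree_lt hP0]
      have := hPd hP0
      omega
  linarith

lemma false_of_counting {M q T : ℕ} {N V : ℕ → ℤ} (hT : T = 59 * (M * q))
    (hM : 0 < M) (hq : q = 17407000 * M + 1) (h₀ : V 0 ≤ N 0)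
    (h₁ : ∀ j < T, 17407 * N j + 413 * (2065 * (j + 1) + 14 * (M * q)) ≤
      17407 * N (j + 1) + 17407 * 826)
    (h₂ : ∀ j < T, 17407 * V (j + 1) + 17407 * 49 * (j + 1) ≤
      17407 * V j + 413 * (2065 * (j + 1) + 14 * (M * q)) + 17407)
    (h₃ : ∀ j < T, T < j + 1 + q → V (j + 1) ≤ V j)
    (h₄ : 2 * N T ≤ 2 * V T + 7 * T * (7 * T + 1)) : False := by
  have stage₁ : ∀ j : ℕ, j ≤ T →
      17407 * (49 * j * (j + 1) - 1654 * (j : ℤ)) ≤ 2 * 17407 * (N j - V j) := by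
    intro j
    induction j with
    | zero => intro _; push_cast; linarith
    | succ j ih =>
      intro hj
      have := ih (by omega)
      have := h₁ j hj
      have := h₂ j hj
      push_cast
      linarith
  obtain ⟨r, hr⟩ : ∃ r, T = r + q := by
    have : q ≤ T := by
      rw [hT, ← mul_assoc]
      exact Nat.le_mul_of_pos_left _ (by positivity)
    exact ⟨T - q, (Nat.sub_add_cancel this).symm⟩
  have hrZ : (r : ℤ) + q = 59 * (M * q) := by exact_mod_cast hr ▸ hT
  have stage₂ : ∀ t : ℕ, t ≤ q →
      17407 * (49 * ((r + t : ℕ) : ℤ) * ((r + t : ℕ) + 1) - 1654 * ((r + t : ℕ) : ℤ)) +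
        98 * (t * (2 * q - t - 1)) ≤ 2 * 17407 * (N (r + t) - V (r + t)) := by
    intro t
    induction t with
    | zero => intro _; simpa using stage₁ r (by omega)
    | succ t ih =>
      intro ht
      have := ih (by omega)
      have := h₁ (r + t) (by omega)
      have := h₃ (r + t) (by omega) (by omega)
      push_cast at *
      rw [← add_assoc r t 1]
      linarith
  have h := stage₂ q le_rfl
  rw [← hr] at h
  have hTZ : (T : ℤ) = 59 * (M * q) := by exact_mod_cast hT
  have hqZ : (q : ℤ) = 17407000 * M + 1 := by exact_mod_cast hq
  have hq0 : 0 < (q : ℤ) := by omega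
  have hMq : 0 < (M * q : ℤ) := by positivity
  have e1 : 98 * (q * (2 * q - q - 1) : ℤ) = 98 * 17407000 * (M * q) := by
    rw [hqZ]; ring
  rw [e1] at h
  nlinarith

theorem not_isNoetherianRing_symbolicRees [CharZero K] :
    ¬ IsNoetherianRing (symbolicRees (pIdeal K 5 103 169)) := by
  intro hN
  obtain ⟨M, hM, hcone⟩ := exists_slope_le_of_isNoetherianRing hN
  obtain ⟨q, hq⟩ : ∃ q, q = 17407000 * M + 1 := ⟨_, rfl⟩
  obtain ⟨T, hT⟩ : ∃ T, T = 59 * (M * q) := ⟨_, rfl⟩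
  let E : ℕ → ℕ := fun j => 2065 * j + 14 * (M * q)
  have hE : ∀ j, E (j + 1) = E j + 2065 := fun j => by simp only [E]; ring
  have hEZ : ∀ j : ℕ, (E j : ℤ) + 2065 = 2065 * (j + 1) + 14 * (M * q) := by
    intro j; simp only [E]; push_cast; ring
  refine false_of_counting (N := fun j => Module.finrank K (homog K (E j)))
    (V := fun j => Module.finrank K (vanishing K (E j) (7 * j))) hT hM hq ?_ ?_ ?_ ?_ ?_
  · exact_mod_cast Submodule.finrank_mono (inf_le_left : vanishing K (E 0) (7 * 0) ≤ homog K (E 0))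
  · intro j _
    have := ncard_exponents_add (E j) (le_refl 413)
    rw [show 5 * 413 = 2065 from rfl, ← finrank_homog (K := K), ← finrank_homog (K := K)] at this
    rw [hE, ← hEZ]
    omega
  · intro j hj
    have hL : 17407 * (7 * j + 7) ≤ 59 * (E j + 2065) := by
      simp only [E]; omega
    have := finrank_vanishing_add_le (K := K) hL
    rw [hE, ← hEZ, mul_add 7 j 1, mul_one]
    zify at this
    linarith
  · intro j hj hjq
    rw [hE, mul_add 7 j 1]
    norm_cast
    refine finrank_vanishing_add_le_of_par_eq_zero fun g hg => ?_
    by_contra h0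
    obtain ⟨hg, hl⟩ := mem_vanishing.mp hg
    have := hcone _ _ g hg hl h0
    zify at this hjq hT
    rw [hEZ] at this
    have hM' : (0 : ℤ) ≤ M := by positivity
    nlinarith [mul_nonneg hM' (show (0 : ℤ) ≤ j + q - T by linarith)]
  · have := finrank_homog_le (K := K) (E T) (7 * T)
    zify at this
    linarith

end

end SpaceMonomial

/-- For `K` a field of characteristic `0`, the symbolic Rees algebra
`R_s(𝔭_K(5,103,169))` is not Noetherian, equivalently not finitely generated
over `S = K[x,y,z]`. -/
theorem statement0 (K : Type*) [Field K] [CharZero K] :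
    ¬ IsNoetherianRing (symbolicRees (pIdeal K 5 103 169)) ∧
    ¬ (symbolicRees (pIdeal K 5 103 169)).FG := by
  have h := SpaceMonomial.not_isNoetherianRing_symbolicRees (K := K)
  refine ⟨h, fun hfg => h ?_⟩
  have := (symbolicRees (pIdeal K 5 103 169)).fg_iff_finiteType.mp hfg
  exact Algebra.FiniteType.isNoetherianRing (MvPolynomial (Fin 3) K) _
end

section
/- Let K be a field and a, b, c pairwise coprime positive integers. Let g1, g2 be homogeneous elements of S forming an S-regular sequence, with g1 ∈ [𝔭_K(a,b,c)^{(r1)}]_{d1} and g2 ∈ [𝔭_K(a,b,c)^{(r2)}]_{d2} for some positive integers r1, r2, d1, d2. Then d1·d2 ≥ a·b·c·r1·r2, i.e., (d1/r1)·(d2/r2) ≥ abc. -/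
open MvPolynomial

namespace PowerSeries

/-- The polynomial `1 + X + ⋯ + X ^ (k - 1)` as a power series. -/
noncomputable def geomPoly (k : ℕ) : PowerSeries ℤ := ∑ i ∈ Finset.range k, X ^ i

lemma geomPoly_mul_one_sub (k : ℕ) : geomPoly k * (1 - X) = 1 - X ^ k := by
  simpa [geomPoly] using geom_sum_mul_neg (X : PowerSeries ℤ) k

/-- Multiplication by `1 + X + ⋯ + X ^ (k - 1)` multiplies an eventual lower bound on coefficients
by `k`. -/
lemma le_coeff_mul_geomPoly {F : PowerSeries ℤ} {e : ℤ} {n₀ : ℕ}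
    (h : ∀ n, n₀ ≤ n → e ≤ coeff n F) (k n : ℕ) (hn : n₀ + k ≤ n) :
    k * e ≤ coeff n (F * geomPoly k) := by
  rw [geomPoly, Finset.mul_sum, map_sum]
  calc (k : ℤ) * e = ∑ _i ∈ Finset.range k, e := by simp
    _ ≤ _ := by
      refine Finset.sum_le_sum fun i hi => ?_
      rw [Finset.mem_range] at hi
      rw [coeff_mul_X_pow', if_pos (by omega)]
      exact h _ (by omega)

/-- If `F * (1 - X ^ a) * (1 - X ^ b) * (1 - X ^ c) = (1 - X ^ d₁) * (1 - X ^ d₂)` then the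
coefficients of `F` have average value `d₁ * d₂ / (a * b * c)` in the long run. -/
lemma mul_le_mul_of_le_coeff {F : PowerSeries ℤ} {e : ℤ} {n₀ : ℕ}
    (h : ∀ n, n₀ ≤ n → e ≤ coeff n F) {a b c d₁ d₂ : ℕ}
    (hF : F * ((1 - X ^ a) * (1 - X ^ b) * (1 - X ^ c)) = (1 - X ^ d₁) * (1 - X ^ d₂)) :
    (a * b * c : ℤ) * e ≤ d₁ * d₂ := by
  have hX : (1 - X : PowerSeries ℤ) ≠ 0 := fun h0 => by
    simpa using congrArg constantCoeff h0
  have hgeom : (mk 1 : PowerSeries ℤ) * (1 - X) = 1 := mk_one_mul_one_sub_eq_one ℤ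
  have key : F * geomPoly a * geomPoly b * geomPoly c = mk 1 * geomPoly d₁ * geomPoly d₂ := by
    apply mul_right_cancel₀ (pow_ne_zero 3 hX)
    simp only [← geomPoly_mul_one_sub] at hF
    linear_combination hF - geomPoly d₁ * geomPoly d₂ * (1 - X) ^ 2 * hgeom
  have h₁ := fun n => le_coeff_mul_geomPoly
    (le_coeff_mul_geomPoly (le_coeff_mul_geomPoly h a) b) c n
  have h₀ : ∀ n, 0 ≤ n → (-1 : ℤ) ≤ coeff n (-mk 1 : PowerSeries ℤ) := fun n _ => by simp
  have h₂ := fun n => le_coeff_mul_geomPoly (le_coeff_mul_geomPoly h₀ d₁) d₂ n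
  specialize h₁ (n₀ + a + b + c + (d₁ + d₂)) (by omega)
  specialize h₂ (n₀ + a + b + c + (d₁ + d₂)) (by omega)
  rw [key] at h₁
  simp only [neg_mul, map_neg] at h₂
  linarith

end PowerSeries

/-- The Hilbert function of the polynomial ring in the grading given by `w`. -/
noncomputable def weightCount {σ : Type*} (w : σ → ℕ) (n : ℕ) : ℕ :=
  Set.ncard {s : σ →₀ ℕ | Finsupp.weight w s = n}

lemma finrank_weightedHomogeneousSubmodule (K : Type*) [Field K] {σ : Type*} (w : σ → ℕ) (n : ℕ) :
    Module.finrank K (weightedHomogeneousSubmodule K w n) = weightCount w n := by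
  rw [weightedHomogeneousSubmodule_eq_finsupp_supported, weightCount]
  refine Eq.trans (AddMonoidAlgebra.supportedEquivFinsupp _).finrank_eq ?_
  rw [Module.finrank, rank_finsupp_self, Cardinal.toNat_lift, ← Nat.card_coe_set_eq, Nat.card]

lemma weightCount_series {σ : Type*} [Fintype σ] (w : σ → ℕ) (hw : ∀ i, 0 < w i) :
    (PowerSeries.mk fun n => (weightCount w n : ℤ)) * ∏ i, (1 - PowerSeries.X ^ w i) = 1 := by
  classical
  have hgeom : ∀ k : ℕ, 0 < k →
      (PowerSeries.mk fun n => if k ∣ n then (1 : ℤ) else 0) * (1 - PowerSeries.X ^ k) = 1 := by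
    intro k hk
    ext n
    rw [mul_sub, mul_one, map_sub, PowerSeries.coeff_mul_X_pow', PowerSeries.coeff_one]
    simp only [PowerSeries.coeff_mk]
    rcases Nat.eq_zero_or_pos n with rfl | hn
    · simp [hk.ne']
    · by_cases hkn : k ≤ n
      · simp [hkn, Nat.dvd_sub_iff_left hkn dvd_rfl, hn.ne']
      · simp [hkn, hn.ne', Nat.not_dvd_of_pos_of_lt hn (not_le.mp hkn)]
  have hprod : (PowerSeries.mk fun n => (weightCount w n : ℤ)) =
      ∏ i, PowerSeries.mk fun n => if w i ∣ n then (1 : ℤ) else 0 := by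
    ext n
    rw [PowerSeries.coeff_prod]
    simp only [PowerSeries.coeff_mk, Finset.prod_ite_zero, Finset.prod_const_one,
      Finset.sum_boole]
    norm_cast
    rw [weightCount, ← Set.ncard_coe_finset]
    refine Set.ncard_congr (fun s _ => Finsupp.equivFunOnFinite.symm fun i => s i * w i) ?_ ?_ ?_
    · intro s hs
      simp only [Set.mem_ofPred_eq, Finsupp.weight_apply, smul_eq_mul] at hs
      rw [Finsupp.sum_fintype _ _ (by simp)] at hs
      simpa using hs
    · intro s t _ _ hst
      ext i
      have := DFunLike.congr_fun hst i
      simpa [(hw i).ne'] using this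
    · intro t ht
      simp only [Finset.coe_filter, Set.mem_ofPred_eq, Finset.mem_finsuppAntidiag,
        Finset.mem_univ, forall_true_left] at ht
      refine ⟨Finsupp.equivFunOnFinite.symm fun i => t i / w i, ?_, ?_⟩
      · simp only [Set.mem_ofPred_eq, Finsupp.weight_apply, smul_eq_mul]
        rw [Finsupp.sum_fintype _ _ (by simp)]
        simp only [Finsupp.coe_equivFunOnFinite_symm]
        rw [← ht.1.1]
        exact Finset.sum_congr rfl fun i _ => Nat.div_mul_cancel (ht.2 i)
      · ext i
        simpa using Nat.div_mul_cancel (ht.2 i)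
  rw [hprod, ← Finset.prod_mul_distrib]
  exact Finset.prod_eq_one fun i _ => hgeom _ (hw i)


namespace Submodule
variable {K V W W' : Type*} [Field K] [AddCommGroup V] [Module K V] [AddCommGroup W] [Module K W]
  [AddCommGroup W'] [Module K W']

lemma finrank_map_add_le (f : V →ₗ[K] W) {p q : Submodule K V} [FiniteDimensional K p]
    (hqp : q ≤ p) :
    Module.finrank K (p.map f) + Module.finrank K q ≤
      Module.finrank K p + Module.finrank K (q.map f) := by
  have : FiniteDimensional K q := finiteDimensional_of_le hqp
  have hp := (f.domRestrict p).finrank_range_add_finrank_ker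
  have hq := (f.domRestrict q).finrank_range_add_finrank_ker
  rw [LinearMap.range_domRestrict] at hp hq
  have hker : Module.finrank K (LinearMap.ker (f.domRestrict q)) ≤
      Module.finrank K (LinearMap.ker (f.domRestrict p)) := by
    refine LinearMap.finrank_le_finrank_of_injective
      (f := (inclusion hqp).restrict fun x hx => ?_) ?_
    · simpa using hx
    · intro x y hxy
      exact Subtype.ext (Subtype.ext (congrArg (fun z : LinearMap.ker (f.domRestrict p) => ((z : p) : V)) hxy))
  omega

lemma finrank_map_le_of_ker_le (f : V →ₗ[K] W) (g : V →ₗ[K] W') (p : Submodule K V)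
    [FiniteDimensional K p] (h : ∀ v ∈ p, f v = 0 → g v = 0) :
    Module.finrank K (p.map g) ≤ Module.finrank K (p.map f) := by
  have hf := (f.domRestrict p).finrank_range_add_finrank_ker
  have hg := (g.domRestrict p).finrank_range_add_finrank_ker
  rw [LinearMap.range_domRestrict] at hf hg
  have hker : LinearMap.ker (f.domRestrict p) ≤ LinearMap.ker (g.domRestrict p) :=
    fun v hv => by simpa using h v v.2 (by simpa using hv)
  have := finrank_mono hker
  omega

end Submodule

/-- The exponents of the monomials in two variables of degree less than `N`. -/
def lowExponents (N : ℕ) : Finset (ℕ × ℕ) := (Finset.range N).biUnion Finset.HasAntidiagonal.antidiagonal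

lemma mem_lowExponents {N : ℕ} {p : ℕ × ℕ} : p ∈ lowExponents N ↔ p.1 + p.2 < N := by
  simp [lowExponents]

lemma card_lowExponents (N : ℕ) : (lowExponents N).card = ∑ k ∈ Finset.range N, (k + 1) := by
  rw [lowExponents, Finset.card_biUnion]
  · simp
  · intro i _ j _ hij
    exact Finset.disjoint_left.mpr fun p hi hj => hij (by simp_all)

lemma card_lowExponents_add (r s : ℕ) :
    (lowExponents (r + s)).card = (lowExponents r).card + (lowExponents s).card + r * s := by
  simp only [card_lowExponents]
  induction s with
  | zero => simp
  | succ s ih => rw [← add_assoc, Finset.sum_range_succ, Finset.sum_range_succ, ih]; ring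

/-- The exponent vector of `X₀ ^ i * X₁ ^ j`. -/
noncomputable def exponentPair (p : ℕ × ℕ) : Fin 2 →₀ ℕ :=
  Finsupp.single 0 p.1 + Finsupp.single 1 p.2

lemma degree_exponentPair (p : ℕ × ℕ) : (exponentPair p).degree = p.1 + p.2 := by
  simp [exponentPair, Finsupp.degree_single]

lemma exponentPair_surjective (d : Fin 2 →₀ ℕ) : exponentPair (d 0, d 1) = d := by
  ext i; fin_cases i <;> simp [exponentPair]

lemma exponentPair_injective : Function.Injective exponentPair := fun p q h => by
  have h0 := DFunLike.congr_fun h 0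
  have h1 := DFunLike.congr_fun h 1
  simp [exponentPair] at h0 h1
  exact Prod.ext h0 h1

namespace MvPowerSeries
variable (K : Type*) [Field K]

/-- The coefficients of degree less than `N` of a power series in two variables. -/
noncomputable def lowCoeff (N : ℕ) : MvPowerSeries (Fin 2) K →ₗ[K] (lowExponents N → K) :=
  LinearMap.pi fun p => coeff (exponentPair p)

variable {K}

lemma lowCoeff_eq_zero_iff {N : ℕ} {f : MvPowerSeries (Fin 2) K} :
    lowCoeff K N f = 0 ↔ N ≤ f.order := by
  constructor
  · intro h
    refine nat_le_order fun d hd => ?_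
    rw [← exponentPair_surjective d] at hd ⊢
    rw [degree_exponentPair] at hd
    exact congrFun h ⟨_, mem_lowExponents.mpr hd⟩
  · intro h
    ext ⟨p, hp⟩
    refine coeff_of_lt_order (lt_of_lt_of_le ?_ h)
    rw [degree_exponentPair]
    exact_mod_cast mem_lowExponents.mp hp

lemma lowCoeff_surjective (N : ℕ) : Function.Surjective (lowCoeff K N) := by
  intro t
  refine ⟨fun d => if h : (d 0, d 1) ∈ lowExponents N then t ⟨_, h⟩ else 0, ?_⟩
  ext ⟨e, he⟩
  change (if h : (exponentPair e 0, exponentPair e 1) ∈ lowExponents N then t ⟨_, h⟩ else 0) = _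
  simp [exponentPair, he]

lemma le_order_sub_sum (N : ℕ) (f : MvPowerSeries (Fin 2) K) :
    (N : ℕ∞) ≤ (f - ∑ p ∈ lowExponents N,
      coeff (exponentPair p) f • (X 0 ^ p.1 * X 1 ^ p.2)).order := by
  classical
  rw [← lowCoeff_eq_zero_iff]
  ext ⟨p, hp⟩
  have hmon : ∀ q : ℕ × ℕ, (X 0 ^ q.1 * X 1 ^ q.2 : MvPowerSeries (Fin 2) K) =
      monomial (exponentPair q) 1 := fun q => by
    rw [X_pow_eq, X_pow_eq, monomial_mul_monomial, one_mul, exponentPair]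
  simp only [hmon]
  simp [lowCoeff, coeff_monomial, exponentPair_injective.eq_iff, mem_lowExponents.mp hp,
    mem_lowExponents]

lemma order_eq_zero_of_constantCoeff_ne_zero {R σ : Type*} [CommRing R] {f : MvPowerSeries σ R}
    (h : constantCoeff f ≠ 0) : f.order = 0 := by
  by_contra h0
  exact h (order_ne_zero_iff_constCoeff_eq_zero.mp h0)

lemma le_order_of_le_order_map {R S σ : Type*} [CommRing R] [CommRing S] {φ : R →+* S}
    (hφ : Function.Injective φ) {n : ℕ} {f : MvPowerSeries σ R} (h : n ≤ (map φ f).order) :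
    n ≤ f.order := by
  refine nat_le_order fun d hd => ?_
  have := coeff_of_lt_order (f := map φ f) (lt_of_lt_of_le (by exact_mod_cast hd) h)
  rwa [coeff_map, map_eq_zero_iff _ hφ] at this

/-- The ideal of power series of order at least `n`. -/
noncomputable def orderIdeal (R σ : Type*) [CommRing R] (n : ℕ) : Ideal (MvPowerSeries σ R) where
  carrier := {f | n ≤ f.order}
  zero_mem' := by simp
  add_mem' hf hg := (le_min hf hg).trans min_order_le_add
  smul_mem' c f hf := le_trans (le_trans hf le_add_self) le_order_mul

lemma orderIdeal_one_pow_le (R σ : Type*) [CommRing R] (n : ℕ) :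
    orderIdeal R σ 1 ^ n ≤ orderIdeal R σ n := by
  induction n with
  | zero => intro f _; simp [orderIdeal]
  | succ n ih =>
    rw [pow_succ, Ideal.mul_le]
    intro f hf g hg
    have hf' : (n : ℕ∞) ≤ f.order := ih hf
    have hg' : ((1 : ℕ) : ℕ∞) ≤ g.order := hg
    change ((n + 1 : ℕ) : ℕ∞) ≤ (f * g).order
    push_cast at hg' ⊢
    exact (add_le_add hf' hg').trans le_order_mul

end MvPowerSeries


lemma exists_mul_mem_pow_of_mem_symbPow {A : Type*} [CommRing A] {Q : Ideal A} [Q.IsPrime] {n : ℕ}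
    {x : A} (hx : x ∈ symbPow Q n) : ∃ s ∉ Q, s * x ∈ Q ^ n := by
  rw [symbPow, Ideal.mem_comap,
    IsLocalization.algebraMap_mem_map_algebraMap_iff Q.primeCompl] at hx
  obtain ⟨s, hs, h⟩ := hx
  exact ⟨s, hs, h⟩

section LocalParameters

variable (K : Type*) [Field K] (p q : ℕ)

/-- The images of `x, y, z` under `toLocal`. -/
noncomputable def localVars : Fin 3 → MvPowerSeries (Fin 2) K :=
  ![(1 + MvPowerSeries.X 0) ^ q, (1 + MvPowerSeries.X 0) ^ p, 1 + MvPowerSeries.X 1]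

/-- The map `K[x,y,z] → K⟦U,V⟧`, `x ↦ (1 + U) ^ q`, `y ↦ (1 + U) ^ p`, `z ↦ 1 + V`. -/
noncomputable def toLocal : MvPolynomial (Fin 3) K →ₐ[K] MvPowerSeries (Fin 2) K :=
  aeval (localVars K p q)

/-- The map `K[x,y,z] → K[T]⟦U,V⟧`, `x ↦ T ^ a * (1 + U) ^ q`, `y ↦ T ^ b * (1 + U) ^ p`,
`z ↦ T ^ c * (1 + V)`. -/
noncomputable def toFamily (w : Fin 3 → ℕ) :
    MvPolynomial (Fin 3) K →+* MvPowerSeries (Fin 2) (Polynomial K) :=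
  eval₂Hom (MvPowerSeries.C.comp Polynomial.C) fun i =>
    MvPowerSeries.C (Polynomial.X ^ w i) * MvPowerSeries.map Polynomial.C (localVars K p q i)

variable {K p q}

lemma constantCoeff_toFamily (a b c : ℕ) (f : MvPolynomial (Fin 3) K) :
    MvPowerSeries.constantCoeff (toFamily K p q (wt a b c) f) = toPoly K a b c f := by
  have : (MvPowerSeries.constantCoeff.comp (toFamily K p q (wt a b c))) =
      (toPoly K a b c : MvPolynomial (Fin 3) K →+* Polynomial K) := by
    ext i
    · simp [toFamily, toPoly]
    · fin_cases i <;> simp [toFamily, toPoly, wt, localVars]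
  exact congrArg (fun h => h f) this

lemma toFamily_of_isWeightedHomogeneous {w : Fin 3 → ℕ} {d : ℕ} {f : MvPolynomial (Fin 3) K}
    (hf : f.IsWeightedHomogeneous w d) :
    toFamily K p q w f =
      MvPowerSeries.C (Polynomial.X ^ d) * MvPowerSeries.map Polynomial.C (toLocal K p q f) := by
  induction hf using IsWeightedHomogeneous.induction_on with
  | zero => simp
  | add f g _ _ hf hg => rw [map_add, hf, hg, map_add, map_add, mul_add]
  | monomial s r hs =>
    rw [← hs, Finsupp.weight_apply, Finsupp.sum_fintype _ _ (by simp)]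
    simp only [toFamily, toLocal, coe_eval₂Hom, eval₂_monomial, aeval_monomial]
    rw [Finsupp.prod_fintype _ _ (by simp), Finsupp.prod_fintype _ _ (by simp)]
    simp only [mul_pow, Finset.prod_mul_distrib, map_mul, map_prod, map_pow, smul_eq_mul,
      ← Finset.prod_pow_eq_pow_sum]
    have : MvPowerSeries.map Polynomial.C (algebraMap K (MvPowerSeries (Fin 2) K) r) =
        MvPowerSeries.C (Polynomial.C r) := MvPowerSeries.map_C _ _
    rw [this]
    simp only [RingHom.comp_apply, ← pow_mul, mul_comm (s _)]
    ring

lemma le_order_toLocal {a b c r d : ℕ} {g : MvPolynomial (Fin 3) K}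
    (hg : g ∈ symbPow (pIdeal K a b c) r) (hgh : g.IsWeightedHomogeneous (wt a b c) d) :
    r ≤ (toLocal K p q g).order := by
  obtain ⟨s, hs, hsg⟩ := exists_mul_mem_pow_of_mem_symbPow hg
  have hle : pIdeal K a b c ≤
      (MvPowerSeries.orderIdeal (Polynomial K) (Fin 2) 1).comap (toFamily K p q (wt a b c)) := by
    intro f hf
    change ((1 : ℕ) : ℕ∞) ≤ MvPowerSeries.order _
    rw [Nat.cast_one, MvPowerSeries.one_le_order_iff_constCoeff_eq_zero, constantCoeff_toFamily]
    exact hf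
  have hmem := ((Ideal.pow_right_mono hle r).trans (Ideal.le_comap_pow _ _)) hsg
  have hord : (r : ℕ∞) ≤ (toFamily K p q (wt a b c) (s * g)).order :=
    MvPowerSeries.orderIdeal_one_pow_le _ _ _ hmem
  have hs0 : (toFamily K p q (wt a b c) s).order = 0 :=
    MvPowerSeries.order_eq_zero_of_constantCoeff_ne_zero (by
      rw [constantCoeff_toFamily]; exact hs)
  have hT : (MvPowerSeries.C (σ := Fin 2) (Polynomial.X ^ d : Polynomial K)).order = 0 :=
    MvPowerSeries.order_eq_zero_of_constantCoeff_ne_zero (by simp)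
  rw [map_mul, MvPowerSeries.order_mul, hs0, zero_add, toFamily_of_isWeightedHomogeneous hgh,
    MvPowerSeries.order_mul, hT, zero_add] at hord
  exact MvPowerSeries.le_order_of_le_order_map Polynomial.C_injective hord

/-- In large degrees, homogeneous polynomials attain all values of the low order coefficients. -/
lemma lowCoeff_toLocal_surjective {a b c : ℕ} (hab : Nat.Coprime a b)
    (hpq : a * p = 1 + b * q) (N n : ℕ)
    (hn : a * b * N + a * c * p * N + a * b ≤ n) (t : lowExponents N → K) :
    ∃ v ∈ weightedHomogeneousSubmodule K (wt a b c) n,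
      MvPowerSeries.lowCoeff K N (toLocal K p q v) = t := by
  classical
  obtain ⟨α, β, hαβ⟩ := Nat.exists_add_mul_eq_of_gcd_dvd_of_mul_pred_le a b
    (n - (a * b * N + a * c * p * N)) (by rw [hab]; exact one_dvd _)
    ((Nat.mul_le_mul (Nat.pred_le a) (Nat.pred_le b)).trans (by omega))
  have hn' : n = a * b * N + a * c * p * N + (α * a + β * b) := by omega
  let x : MvPolynomial (Fin 3) K := X 0
  let y : MvPolynomial (Fin 3) K := X 1
  let z : MvPolynomial (Fin 3) K := X 2
  let U : MvPowerSeries (Fin 2) K := MvPowerSeries.X 0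
  let V : MvPowerSeries (Fin 2) K := MvPowerSeries.X 1
  let M : ℕ × ℕ → MvPolynomial (Fin 3) K := fun e =>
    (y ^ a - x ^ b) ^ e.1 * (x ^ b) ^ (N - e.1) *
      ((z * y ^ (c * q) - x ^ (c * p)) ^ e.2 * (x ^ (c * p)) ^ (N - e.2)) * (x ^ α * y ^ β)
  let m : ℕ := b * q * N + c * p * q * N + q * α + p * β
  have hx : toLocal K p q x = (1 + U) ^ q := by simp [toLocal, localVars, x, U]
  have hy : toLocal K p q y = (1 + U) ^ p := by simp [toLocal, localVars, y, U]
  have hz : toLocal K p q z = 1 + V := by simp [toLocal, localVars, z, V]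
  have hM : ∀ e ∈ lowExponents N, toLocal K p q (M e) = (1 + U) ^ m * (U ^ e.1 * V ^ e.2) := by
    intro e he
    rw [mem_lowExponents] at he
    have h1 : toLocal K p q (y ^ a - x ^ b) = (1 + U) ^ (b * q) * U := by
      rw [map_sub, map_pow, map_pow, hx, hy, ← pow_mul, ← pow_mul, mul_comm p, hpq, pow_add,
        mul_comm q]
      ring
    have h2 : toLocal K p q (z * y ^ (c * q) - x ^ (c * p)) = (1 + U) ^ (c * p * q) * V := by
      rw [map_sub, map_mul, map_pow, map_pow, hx, hy, hz, ← pow_mul, ← pow_mul]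
      ring
    simp only [M, map_mul, map_pow, h1, h2]
    simp only [hx, hy, mul_pow, ← pow_mul]
    have hm : m = b * q * e.1 + q * (b * (N - e.1)) + c * p * q * e.2 + q * (c * p * (N - e.2)) +
        q * α + p * β := by
      obtain ⟨k, hk⟩ := Nat.exists_eq_add_of_le (show e.1 ≤ N by omega)
      obtain ⟨l, hl⟩ := Nat.exists_eq_add_of_le (show e.2 ≤ N by omega)
      have hk' : N - e.1 = k := by omega
      have hl' : N - e.2 = l := by omega
      rw [hk', hl']
      calc m = b * q * N + c * p * q * N + q * α + p * β := rfl
        _ = b * q * (e.1 + k) + c * p * q * (e.2 + l) + q * α + p * β := by rw [← hk, ← hl]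
        _ = _ := by ring
    rw [hm]
    simp only [pow_add]
    ring
  have hxw : x.IsWeightedHomogeneous (wt a b c) a := isWeightedHomogeneous_X K (wt a b c) 0
  have hyw : y.IsWeightedHomogeneous (wt a b c) b := isWeightedHomogeneous_X K (wt a b c) 1
  have hzw : z.IsWeightedHomogeneous (wt a b c) c := isWeightedHomogeneous_X K (wt a b c) 2
  have hMw : ∀ e ∈ lowExponents N, (M e).IsWeightedHomogeneous (wt a b c) n := by
    intro e he
    rw [mem_lowExponents] at he
    have h1 : (y ^ a - x ^ b).IsWeightedHomogeneous (wt a b c) (a * b) :=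
      (by simpa using hyw.pow a : (y ^ a).IsWeightedHomogeneous (wt a b c) (a * b)).sub
        (by simpa [mul_comm] using hxw.pow b)
    have h2 : (z * y ^ (c * q) - x ^ (c * p)).IsWeightedHomogeneous (wt a b c) (a * c * p) := by
      have h3 := hzw.mul (hyw.pow (c * q))
      have h4 := hxw.pow (c * p)
      rw [show c + (c * q) • b = a * c * p by
        rw [smul_eq_mul]; calc c + c * q * b = c * (1 + b * q) := by ring
            _ = _ := by rw [← hpq]; ring] at h3
      rw [show (c * p) • a = a * c * p by rw [smul_eq_mul]; ring] at h4
      exact h3.sub h4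
    have h5 := (((h1.pow e.1).mul ((hxw.pow b).pow (N - e.1))).mul
      ((h2.pow e.2).mul ((hxw.pow (c * p)).pow (N - e.2)))).mul ((hxw.pow α).mul (hyw.pow β))
    convert h5 using 1
    obtain ⟨k, hk⟩ := Nat.exists_eq_add_of_le (show e.1 ≤ N by omega)
    obtain ⟨l, hl⟩ := Nat.exists_eq_add_of_le (show e.2 ≤ N by omega)
    have hk' : N - e.1 = k := by omega
    have hl' : N - e.2 = l := by omega
    rw [hk', hl', hn']
    simp only [smul_eq_mul]
    calc _ = a * b * (e.1 + k) + a * c * p * (e.2 + l) + (α * a + β * b) := by rw [← hk, ← hl]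
      _ = _ := by ring
  have hunit : IsUnit ((1 + U) ^ m) := by
    rw [MvPowerSeries.isUnit_iff_constantCoeff]
    simp [U]
  obtain ⟨W, hW⟩ := hunit.exists_right_inv
  obtain ⟨f, hf⟩ := MvPowerSeries.lowCoeff_surjective N t
  refine ⟨∑ e ∈ lowExponents N, MvPowerSeries.coeff (exponentPair e) (W * f) • M e,
    Submodule.sum_mem _ fun e he => Submodule.smul_mem _ _ (hMw e he), ?_⟩
  have hrem := MvPowerSeries.le_order_sub_sum N (W * f)
  have : (N : ℕ∞) ≤ ((1 + U) ^ m * (W * f - ∑ e ∈ lowExponents N,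
      MvPowerSeries.coeff (exponentPair e) (W * f) • (U ^ e.1 * V ^ e.2))).order :=
    (hrem.trans le_add_self).trans MvPowerSeries.le_order_mul
  rw [← MvPowerSeries.lowCoeff_eq_zero_iff, mul_sub, ← mul_assoc, hW, one_mul, map_sub,
    sub_eq_zero, hf] at this
  rw [this, map_sum, Finset.mul_sum]
  congr 1
  refine Finset.sum_congr rfl fun e he => ?_
  rw [map_smul, hM e he, mul_smul_comm]

end LocalParameters

lemma finiteDimensional_weightedHomogeneousSubmodule (K : Type*) [Field K] {σ : Type*} [Finite σ]
    {w : σ → ℕ} (hw : ∀ i, 0 < w i) (n : ℕ) :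
    FiniteDimensional K (weightedHomogeneousSubmodule K w n) :=
  Module.Finite.iff_fg.mpr (weightedHomogeneousSubmodule_fg K w (fun i => (hw i).ne') n)

lemma MvPolynomial.IsWeightedHomogeneous.exists_eq_mul {K σ : Type*} [Field K] {w : σ → ℕ}
    {g u : MvPolynomial σ K} {d n : ℕ} (hg : g.IsWeightedHomogeneous w d)
    (hu : u.IsWeightedHomogeneous w (d + n)) (h : g ∣ u) :
    ∃ v : MvPolynomial σ K, v.IsWeightedHomogeneous w n ∧ u = g * v := by
  classical
  obtain ⟨v, rfl⟩ := h
  let := weightedGradedAlgebra K w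
  have hdec := DirectSum.coe_decompose_mul_of_left_mem (weightedHomogeneousSubmodule K w) (d + n)
    (b := v) hg
  rw [if_pos (Nat.le_add_right d n), Nat.add_sub_cancel_left,
    DirectSum.decompose_of_mem_same _ hu] at hdec
  exact ⟨_, (DirectSum.decompose (weightedHomogeneousSubmodule K w) v n).2, hdec⟩

namespace RingTheory.Sequence.IsRegular
variable {R : Type*} [CommRing R] {f g : R}

lemma left_ne_zero [Nontrivial R] (h : IsRegular R [f, g]) : f ≠ 0 := by
  rintro rfl
  exact one_ne_zero (((isWeaklyRegular_cons_iff R _ _).mp h.toIsWeaklyRegular).1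
    (show (0 : R) • (1 : R) = (0 : R) • (0 : R) by simp))

lemma dvd_of_dvd_mul (h : IsRegular R [f, g]) {v : R} (hv : f ∣ g * v) : f ∣ v := by
  have h2 := ((isWeaklyRegular_cons_iff R _ _).mp h.toIsWeaklyRegular).2
  rw [isWeaklyRegular_singleton_iff] at h2
  have := mem_of_isSMulRegular_quotient_of_smul_mem h2 (x := v)
  simp [← Submodule.ideal_span_singleton_smul, Ideal.mem_span_singleton] at this
  exact this hv

lemma right_ne_zero (h : IsRegular R [f, g]) : g ≠ 0 := by
  rintro rfl
  have h1 : f ∣ 1 := h.dvd_of_dvd_mul (by simp)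
  refine h.top_ne_smul ?_
  have : Ideal.ofList [f, 0] = ⊤ := by
    rw [Ideal.eq_top_iff_one]
    exact Ideal.mem_of_dvd _ h1 (Ideal.subset_span (by simp))
  rw [this]; simp

end RingTheory.Sequence.IsRegular

/-- A lower bound for the Hilbert function of `K[x,y,z] / (g₁, g₂)` in terms of the orders of `g₁`
and `g₂` at a point of the curve. -/
lemma le_weightCount_sub {K : Type*} [Field K] {a b c p q : ℕ}
    (ha : 0 < a) (hb : 0 < b) (hc : 0 < c) (hab : Nat.Coprime a b) (hpq : a * p = 1 + b * q)
    {g₁ g₂ : MvPolynomial (Fin 3) K} {r₁ r₂ d₁ d₂ : ℕ}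
    (hreg : RingTheory.Sequence.IsRegular (MvPolynomial (Fin 3) K) [g₁, g₂])
    (hg₁ : r₁ ≤ (toLocal K p q g₁).order) (hg₁h : g₁.IsWeightedHomogeneous (wt a b c) d₁)
    (hg₂ : r₂ ≤ (toLocal K p q g₂).order) (hg₂h : g₂.IsWeightedHomogeneous (wt a b c) d₂)
    {n : ℕ} (hn : a * b * (r₁ + r₂) + a * c * p * (r₁ + r₂) + a * b ≤ n + d₁ + d₂) :
    r₁ * r₂ + weightCount (wt a b c) (n + d₂) + weightCount (wt a b c) (n + d₁) ≤
      weightCount (wt a b c) (n + d₁ + d₂) + weightCount (wt a b c) n := by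
  have hw : ∀ i, 0 < wt a b c i := by
    intro i; fin_cases i <;> simpa [wt]
  have hfin := finiteDimensional_weightedHomogeneousSubmodule K hw
  have hmul : ∀ {g : MvPolynomial (Fin 3) K}, g ≠ 0 → ∀ m, Module.finrank K
      ((weightedHomogeneousSubmodule K (wt a b c) m).map (LinearMap.mulLeft K g)) =
        weightCount (wt a b c) m := fun hg m => by
    rw [← finrank_weightedHomogeneousSubmodule K]
    exact (Submodule.equivMapOfInjective _ (mul_right_injective₀ hg) _).finrank_eq.symm
  have hlow : ∀ {g : MvPolynomial (Fin 3) K} {r s N : ℕ}, N = r + s → r ≤ (toLocal K p q g).order → ∀ m,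
      Module.finrank K (((weightedHomogeneousSubmodule K (wt a b c) m).map
        (LinearMap.mulLeft K g)).map
          (MvPowerSeries.lowCoeff K N ∘ₗ (toLocal K p q).toLinearMap)) ≤
        (lowExponents s).card := by
    rintro g r s _ rfl hg m
    rw [← Submodule.map_comp]
    refine (Submodule.finrank_map_le_of_ker_le
      (MvPowerSeries.lowCoeff K s ∘ₗ (toLocal K p q).toLinearMap) _ _ fun v _ hv => ?_).trans
      ((Submodule.finrank_le _).trans (by simp))
    simp only [LinearMap.comp_apply, AlgHom.toLinearMap_apply, LinearMap.mulLeft_apply, map_mul,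
      MvPowerSeries.lowCoeff_eq_zero_iff, MvPowerSeries.order_mul] at hv ⊢
    push_cast
    exact add_le_add hg hv
  let M₁ := (weightedHomogeneousSubmodule K (wt a b c) (n + d₂)).map (LinearMap.mulLeft K g₁)
  let M₂ := (weightedHomogeneousSubmodule K (wt a b c) (n + d₁)).map (LinearMap.mulLeft K g₂)
  let τ := MvPowerSeries.lowCoeff K (r₁ + r₂) ∘ₗ (toLocal K p q).toLinearMap
  have h₁ : Module.finrank K M₁ = _ := hmul hreg.left_ne_zero _
  have h₂ : Module.finrank K M₂ = _ := hmul hreg.right_ne_zero _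
  have hsup := Submodule.finrank_sup_add_finrank_inf_eq M₁ M₂
  have hinf : Module.finrank K ↥(M₁ ⊓ M₂) ≤ weightCount (wt a b c) n := by
    rw [← hmul (mul_ne_zero hreg.left_ne_zero hreg.right_ne_zero) n]
    refine Submodule.finrank_mono ?_
    rintro _ ⟨⟨u, hu, rfl⟩, ⟨v, hv, huv⟩⟩
    simp only [LinearMap.mulLeft_apply] at huv
    have hv' : v.IsWeightedHomogeneous (wt a b c) (d₁ + n) := by rw [add_comm]; exact hv
    obtain ⟨v', hv'h, rfl⟩ := hg₁h.exists_eq_mul hv'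
      (hreg.dvd_of_dvd_mul ⟨u, huv⟩)
    exact ⟨v', hv'h, by simp only [LinearMap.mulLeft_apply]; rw [← huv]; ring⟩
  have hle : M₁ ⊔ M₂ ≤ weightedHomogeneousSubmodule K (wt a b c) (n + d₁ + d₂) := by
    refine sup_le ?_ ?_
    · rintro _ ⟨u, hu, rfl⟩
      have := hg₁h.mul hu
      rwa [show d₁ + (n + d₂) = n + d₁ + d₂ by ring] at this
    · rintro _ ⟨u, hu, rfl⟩
      have := hg₂h.mul hu
      rwa [add_comm d₂] at this
  have hcodim := Submodule.finrank_map_add_le τ hle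
  rw [finrank_weightedHomogeneousSubmodule] at hcodim
  have htop : (weightedHomogeneousSubmodule K (wt a b c) (n + d₁ + d₂)).map τ = ⊤ := by
    rw [eq_top_iff]
    intro t _
    obtain ⟨v, hv, hvt⟩ := lowCoeff_toLocal_surjective (c := c) hab hpq _ _ hn t
    exact ⟨v, hv, hvt⟩
  have hcard : Module.finrank K ((weightedHomogeneousSubmodule K (wt a b c) (n + d₁ + d₂)).map τ) =
      (lowExponents (r₁ + r₂)).card := by
    rw [htop, finrank_top]; simp
  have himg : Module.finrank K ((M₁ ⊔ M₂).map τ) ≤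
      (lowExponents r₂).card + (lowExponents r₁).card := by
    rw [Submodule.map_sup]
    refine (Submodule.finrank_add_le_finrank_add_finrank _ _).trans (add_le_add ?_ ?_)
    · exact hlow rfl hg₁ _
    · exact hlow (add_comm _ _) hg₂ _
  have := card_lowExponents_add r₁ r₂
  omega

/-- if `g1 ∈ [𝔭^{(r1)}]_{d1}`, `g2 ∈ [𝔭^{(r2)}]_{d2}` form a regular
sequence, then `(d1/r1)·(d2/r2) ≥ abc`, i.e. `d1·d2 ≥ abc·r1·r2`. -/
theorem statement1 (K : Type*) [Field K] (a b c : ℕ)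
    (ha : 0 < a) (hb : 0 < b) (hc : 0 < c)
    (hab : Nat.Coprime a b) (hbc : Nat.Coprime b c) (hca : Nat.Coprime c a)
    (g1 g2 : MvPolynomial (Fin 3) K) (r1 r2 d1 d2 : ℕ)
    (hr1 : 0 < r1) (hr2 : 0 < r2) (hd1 : 0 < d1) (hd2 : 0 < d2)
    (hreg : RingTheory.Sequence.IsRegular (MvPolynomial (Fin 3) K) [g1, g2])
    (hg1 : g1 ∈ symbPow (pIdeal K a b c) r1)
    (hg1h : g1.IsWeightedHomogeneous (wt a b c) d1)
    (hg2 : g2 ∈ symbPow (pIdeal K a b c) r2)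
    (hg2h : g2.IsWeightedHomogeneous (wt a b c) d2) :
    a * b * c * (r1 * r2) ≤ d1 * d2 := by
  obtain ⟨p, q, hpq⟩ : ∃ p q, a * p = 1 + b * q := by
    obtain ⟨m, -, hm⟩ := Nat.exists_mul_mod_eq_of_coprime 1 hab hb.ne'
    have hmod : 1 ≡ a * (m + b) [MOD b] := by
      simpa [Nat.ModEq, mul_add] using hm.symm
    obtain ⟨q, hq⟩ := (Nat.modEq_iff_dvd' (by nlinarith)).mp hmod
    have : 1 ≤ a * (m + b) := Nat.mul_pos ha (by omega)
    exact ⟨m + b, q, by omega⟩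
  let H : PowerSeries ℤ := PowerSeries.mk fun n => (weightCount (wt a b c) n : ℤ)
  have hH :
      H * ((1 - PowerSeries.X ^ a) * (1 - PowerSeries.X ^ b) * (1 - PowerSeries.X ^ c)) = 1 := by
    have := weightCount_series (wt a b c) (by intro i; fin_cases i <;> simpa [wt])
    simpa [Fin.prod_univ_three, wt, H] using this
  have hle : ∀ n, a * b * (r1 + r2) + a * c * p * (r1 + r2) + a * b + d1 + d2 ≤ n →
      ((r1 * r2 : ℕ) : ℤ) ≤
        PowerSeries.coeff n (H * ((1 - PowerSeries.X ^ d1) * (1 - PowerSeries.X ^ d2))) := by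
    intro n hn
    obtain ⟨n, rfl⟩ : ∃ m, n = m + d1 + d2 := ⟨n - d1 - d2, by omega⟩
    have := le_weightCount_sub ha hb hc hab hpq hreg (le_order_toLocal hg1 hg1h) hg1h
      (le_order_toLocal hg2 hg2h) hg2h (n := n) (by omega)
    rw [show H * ((1 - PowerSeries.X ^ d1) * (1 - PowerSeries.X ^ d2)) =
      H - H * PowerSeries.X ^ d1 - H * PowerSeries.X ^ d2 + H * PowerSeries.X ^ (d1 + d2) by ring]
    simp only [map_add, map_sub, PowerSeries.coeff_mul_X_pow', H, PowerSeries.coeff_mk]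
    rw [if_pos (by omega), if_pos (by omega), if_pos (by omega),
      show n + d1 + d2 - d1 = n + d2 by omega, show n + d1 + d2 - d2 = n + d1 by omega,
      show n + d1 + d2 - (d1 + d2) = n by omega]
    omega
  have := PowerSeries.mul_le_mul_of_le_coeff hle (a := a) (b := b) (c := c) (d₁ := d1) (d₂ := d2)
    (by linear_combination ((1 - PowerSeries.X ^ d1) * (1 - PowerSeries.X ^ d2)) * hH)
  exact_mod_cast this
end
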